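/- arXiv:2512.01857 — 4 statements merged into one kernel-verified Lean document; each statement's English description precedes it below -/
import Mathlib

section
/- For all positive integers s, p, d and every d-ample (s+2p, p)-constellation C = (S_C, L_C), there exists a subset S ⊆ S_C with |S| = s such that (S, L_C) induces a d-ample (s, p)-constellation in which, moreover, no vertex of S has a neighbor on any path P ∈ L_C at distance (in P) less than d from an endpoint of P. -/
open SimpleGraph

namespace Paper

variable {V W : Type*}

/-- `H` occurs as a subgraph of `G`: an injective map preserving adjacency. -/
def HasSubgraphCopy (G : SimpleGraph V) (H : SimpleGraph W) : Prop :=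
  ∃ f : W → V, Function.Injective f ∧ ∀ u v, H.Adj u v → G.Adj (f u) (f v)

/-- The complete bipartite graph `K_{t,t}`. -/
def Ktt (t : ℕ) : SimpleGraph (Fin t ⊕ Fin t) := completeBipartiteGraph (Fin t) (Fin t)

/-- The claw `K_{1,3}`. -/
def clawGraph : SimpleGraph (Fin 1 ⊕ Fin 3) := completeBipartiteGraph (Fin 1) (Fin 3)

/-- An induced minor model of `H` in `G`: pairwise disjoint nonempty connected branch
sets such that there is an edge between two branch sets iff the corresponding vertices
of `H` are adjacent. -/
def IsInducedMinorModel (H : SimpleGraph W) (G : SimpleGraph V) (M : W → Set V) : Prop :=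
  (∀ v, (M v).Nonempty) ∧
  (∀ v, (G.induce (M v)).Connected) ∧
  (Pairwise fun u v => Disjoint (M u) (M v)) ∧
  (∀ u v, u ≠ v → ((∃ a ∈ M u, ∃ b ∈ M v, G.Adj a b) ↔ H.Adj u v))

/-- `H` is an induced minor of `G`. -/
def InducedMinor (H : SimpleGraph W) (G : SimpleGraph V) : Prop :=
  ∃ M : W → Set V, IsInducedMinorModel H G M

/-- `G` admits a path-decomposition of width at most `w`. -/
def HasPWAtMost (G : SimpleGraph V) (w : ℕ) : Prop :=
  ∃ (m : ℕ) (B : Fin (m + 1) → Set V),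
    (∀ v, ∃ i, v ∈ B i) ∧
    (∀ u v, G.Adj u v → ∃ i, u ∈ B i ∧ v ∈ B i) ∧
    (∀ v, ∀ i j k : Fin (m + 1), i ≤ j → j ≤ k → v ∈ B i → v ∈ B k → v ∈ B j) ∧
    (∀ i, (B i).ncard ≤ w + 1)

/-- The pathwidth of `G`. -/
noncomputable def pathwidth (G : SimpleGraph V) : ℕ := sInf {w | HasPWAtMost G w}

/-- A class of (finite) graphs. -/
abbrev GraphClass := Set ((n : ℕ) × SimpleGraph (Fin n))

/-- A class of graphs is weakly sparse if it excludes some biclique `K_{t,t}` as a subgraph. -/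
def WeaklySparseClass (𝒞 : GraphClass) : Prop :=
  ∃ t : ℕ, 1 ≤ t ∧ ∀ G ∈ 𝒞, ¬ HasSubgraphCopy G.2 (Ktt t)

/-- A class of graphs has bounded pathwidth. -/
def BddPathwidth (𝒞 : GraphClass) : Prop :=
  ∃ w : ℕ, ∀ G ∈ 𝒞, pathwidth G.2 ≤ w

/-- A graph `H` is positive if every weakly sparse class of graphs excluding `H` as an
induced minor has bounded pathwidth. -/
def IsPositive (H : SimpleGraph W) : Prop :=
  ∀ 𝒞 : GraphClass, WeaklySparseClass 𝒞 → (∀ G ∈ 𝒞, ¬ InducedMinor H G.2) →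
    BddPathwidth 𝒞

/-- A graph `H` is negative if some weakly sparse class of graphs excluding `H` as an
induced minor has unbounded pathwidth. -/
def IsNegative (H : SimpleGraph W) : Prop :=
  ∃ 𝒞 : GraphClass, WeaklySparseClass 𝒞 ∧ (∀ G ∈ 𝒞, ¬ InducedMinor H G.2) ∧
    ¬ BddPathwidth 𝒞

/-- The closed neighborhood of a set of vertices. -/
def closedNbhd (G : SimpleGraph V) (S : Set V) : Set V :=
  {x | x ∈ S ∨ ∃ s ∈ S, G.Adj s x}

/-- The set `A` induces a claw in `G`. -/
def IsClawSet (G : SimpleGraph V) (A : Set V) : Prop :=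
  Nonempty ((G.induce A) ≃g clawGraph)

/-- `v` is the center of the claw induced by `A`. -/
def IsClawCenter (G : SimpleGraph V) (A : Set V) (v : V) : Prop :=
  v ∈ A ∧ ∀ u ∈ A, u ≠ v → G.Adj v u

/-- `v` is a leaf of the claw induced by `A`. -/
def IsClawLeaf (G : SimpleGraph V) (A : Set V) (v : V) : Prop :=
  v ∈ A ∧ ¬ IsClawCenter G A v

/-- `G` is (isomorphic to) a path graph. -/
def IsPathGraph (G : SimpleGraph V) : Prop :=
  ∃ n : ℕ, Nonempty (G ≃g pathGraph n)

/-- Any two vertices of `Y` and `Z` are joined by a walk avoiding `S`. -/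
def SameComponentAvoiding (G : SimpleGraph V) (Y Z S : Set V) : Prop :=
  ∀ u ∈ Y, ∀ v ∈ Z, ∃ p : G.Walk u v, ∀ x ∈ p.support, x ∉ S

/-- Some vertex of `Y` is joined to some vertex of `Z` by a walk avoiding `S`. -/
def ConnectsAvoiding (G : SimpleGraph V) (Y Z S : Set V) : Prop :=
  ∃ u ∈ Y, ∃ v ∈ Z, ∃ p : G.Walk u v, ∀ x ∈ p.support, x ∉ S

/-- There is an `A`–`B` path all of whose vertices avoid `S`. -/
def PathBetweenAvoiding (G : SimpleGraph V) (A B S : Set V) : Prop :=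
  ∃ a ∈ A, ∃ b ∈ B, ∃ p : G.Walk a b, p.IsPath ∧ ∀ x ∈ p.support, x ∉ S

/-- `a`, `b`, `c` form an asteroidal triple in `G`. -/
def AsteroidalTriple (G : SimpleGraph V) (a b c : V) : Prop :=
  a ≠ b ∧ a ≠ c ∧ b ≠ c ∧ ¬ G.Adj a b ∧ ¬ G.Adj a c ∧ ¬ G.Adj b c ∧
  ConnectsAvoiding G {a} {b} (closedNbhd G {c}) ∧
  ConnectsAvoiding G {a} {c} (closedNbhd G {b}) ∧
  ConnectsAvoiding G {b} {c} (closedNbhd G {a})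

/-- Selector for three sets. -/
def pick3 (A B C : Set V) : Fin 3 → Set V :=
  fun i => if i = 0 then A else if i = 1 then B else C

/-- The graph obtained from `G` by contracting each of the three disjoint sets
`A`, `B`, `C` into a single vertex. -/
def contractThree (G : SimpleGraph V) (A B C : Set V) :
    SimpleGraph ({x : V // x ∉ A ∪ B ∪ C} ⊕ Fin 3) :=
  SimpleGraph.fromRel (fun a b =>
    match a, b with
    | Sum.inl x, Sum.inl y => G.Adj x.1 y.1
    | Sum.inl x, Sum.inr i => ∃ s ∈ pick3 A B C i, G.Adj x.1 s
    | Sum.inr i, Sum.inr j => ∃ s ∈ pick3 A B C i, ∃ t ∈ pick3 A B C j, G.Adj s t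
    | Sum.inr _, Sum.inl _ => False)

/-- Three pairwise disjoint claws whose contraction into single vertices `a`, `b`, `c`
yields a forest in which `a`, `b`, `c` form an asteroidal triple. -/
def ThreeClawsConfig (F : SimpleGraph V) : Prop :=
  ∃ A B C : Set V, IsClawSet F A ∧ IsClawSet F B ∧ IsClawSet F C ∧
    Disjoint A B ∧ Disjoint A C ∧ Disjoint B C ∧
    (contractThree F A B C).IsAcyclic ∧
    AsteroidalTriple (contractThree F A B C) (Sum.inr 0) (Sum.inr 1) (Sum.inr 2)

/-- There is at most one edge of `G` between `S` and `T`. -/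
def AtMostOneCrossEdge (G : SimpleGraph V) (S T : Set V) : Prop :=
  ∀ x ∈ S, ∀ y ∈ T, G.Adj x y → ∀ x' ∈ S, ∀ y' ∈ T, G.Adj x' y' → x = x' ∧ y = y'

/-- Four pairwise disjoint claws `A`, `B`, `C`, `D`, an `A`–`B` path avoiding `N[C ∪ D]`,
a `C`–`D` path avoiding `N[A ∪ B]`, and at most one edge between `A ∪ B` and `C ∪ D`. -/
def FourClawsCore (H : SimpleGraph V) (A B C D : Set V) : Prop :=
  IsClawSet H A ∧ IsClawSet H B ∧ IsClawSet H C ∧ IsClawSet H D ∧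
  Disjoint A B ∧ Disjoint A C ∧ Disjoint A D ∧
  Disjoint B C ∧ Disjoint B D ∧ Disjoint C D ∧
  PathBetweenAvoiding H A B (closedNbhd H (C ∪ D)) ∧
  PathBetweenAvoiding H C D (closedNbhd H (A ∪ B)) ∧
  AtMostOneCrossEdge H (A ∪ B) (C ∪ D)

/-- Four-claw configuration in which the possible edge between `A ∪ B` and `C ∪ D` joins
a leaf of one of the claws `A`, `B` to a leaf of one of the claws `C`, `D`. -/
def NdsConfig (H : SimpleGraph V) (A B C D : Set V) : Prop :=
  FourClawsCore H A B C D ∧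
  ∀ x ∈ A ∪ B, ∀ y ∈ C ∪ D, H.Adj x y →
    (IsClawLeaf H A x ∨ IsClawLeaf H B x) ∧ (IsClawLeaf H C y ∨ IsClawLeaf H D y)

/-- Four-claw configuration in which the possible edge between `A ∪ B` and `C ∪ D` is not
incident to any of the four claw centers. -/
def NdsConfigCenters (H : SimpleGraph V) (A B C D : Set V) : Prop :=
  FourClawsCore H A B C D ∧
  ∀ x ∈ A ∪ B, ∀ y ∈ C ∪ D, H.Adj x y → ∀ c : V,
    (IsClawCenter H A c ∨ IsClawCenter H B c ∨ IsClawCenter H C c ∨ IsClawCenter H D c) →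
    x ≠ c ∧ y ≠ c

/-- Configuration of three sets as in the Pohoata–Davies grid lemma. -/
def NpdConfig (H : SimpleGraph V) (A B C : Set V) : Prop :=
  A.Nonempty ∧ B.Nonempty ∧ C.Nonempty ∧
  ∀ i : Fin 3,
    (∀ j : Fin 3, j ≠ i → Disjoint (closedNbhd H (pick3 A B C i)) (pick3 A B C j)) ∧
    (H.induce (pick3 A B C i)).Connected ∧
    ¬ IsPathGraph (H.induce (pick3 A B C i)) ∧
    ∀ j k : Fin 3, j ≠ i → k ≠ i →
      SameComponentAvoiding H (pick3 A B C j) (pick3 A B C k)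
        (closedNbhd H (pick3 A B C i))

/-- The `n × n` Pohoata–Davies grid: `n` paths on `n` vertices each (vertex `(j, i)` is
the `i`-th vertex of the `j`-th path), together with, for each `i`, a star vertex
adjacent to the `i`-th vertex of each path. -/
def pdGrid (n : ℕ) : SimpleGraph (Fin n × Fin n ⊕ Fin n) :=
  SimpleGraph.fromRel (fun a b =>
    match a, b with
    | Sum.inl p, Sum.inl q => p.1 = q.1 ∧ (p.2 : ℕ) + 1 = (q.2 : ℕ)
    | Sum.inl p, Sum.inr s => p.2 = s
    | _, _ => False)

/-- The death star of height `n`: its path has `2^n - 1` vertices, and the star vertex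
added at height `k+1` (for `k : Fin n`) is adjacent exactly to the path vertices `i`
with `i ≡ 2^(n-1-k) - 1 (mod 2^(n-k))`. -/
def deathStar (n : ℕ) : SimpleGraph (Fin (2 ^ n - 1) ⊕ Fin n) :=
  SimpleGraph.fromRel (fun a b =>
    match a, b with
    | Sum.inl i, Sum.inl j => (i : ℕ) + 1 = (j : ℕ)
    | Sum.inl i, Sum.inr k => (i : ℕ) % 2 ^ (n - (k : ℕ)) = 2 ^ (n - 1 - (k : ℕ)) - 1
    | _, _ => False)

/-- The tree `T_{1,ℓ}`: a root adjacent to the central vertex of each of `ℓ` disjoint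
paths on `2ℓ + 1` vertices. -/
def T1Graph (ℓ : ℕ) : SimpleGraph (Unit ⊕ Fin ℓ × Fin (2 * ℓ + 1)) :=
  SimpleGraph.fromRel (fun a b =>
    match a, b with
    | Sum.inl _, Sum.inr p => (p.2 : ℕ) = ℓ
    | Sum.inr p, Sum.inr q => p.1 = q.1 ∧ (p.2 : ℕ) + 1 = (q.2 : ℕ)
    | _, _ => False)

/-- Vertices of `T_{2,ℓ}` and `T_{3,ℓ}`: the root; the `ℓ` original leaves adjacent to
the root; the two subdivided paths `x_0, …, x_{ℓ+1}` and `y_0, …, y_{ℓ+1}` (with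
`x = x_0`, `y = y_0` the non-leaf children of the root); three attached `ℓ`-edge paths;
and `ℓ + 3` glued copies of `T_{1,ℓ}` (each consisting of `ℓ` paths on `2ℓ+1` vertices,
the root of the copy being identified with the glue site). -/
abbrev TVert (ℓ : ℕ) : Type :=
  Unit ⊕ Fin ℓ ⊕ (Fin 2 × Fin (ℓ + 2)) ⊕ (Fin 3 × Fin ℓ) ⊕
    (Fin (ℓ + 3) × Fin ℓ × Fin (2 * ℓ + 1))

/-- The `ℓ + 3` glue sites of a copy of `T_{1,ℓ}`: site `0` is `x`; site `1` is the far
end `x_{ℓ+1}`; site `2` is the far end `y_{ℓ+1}`; sites `3, …, ℓ+2` are the `ℓ` original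
leaves adjacent to the root. -/
def glueSite (ℓ : ℕ) (k : Fin (ℓ + 3)) : TVert ℓ :=
  if h : 3 ≤ (k : ℕ) then Sum.inr (Sum.inl ⟨(k : ℕ) - 3, by have := k.isLt; omega⟩)
  else if (k : ℕ) = 0 then Sum.inr (Sum.inr (Sum.inl (0, ⟨0, by omega⟩)))
  else if (k : ℕ) = 1 then Sum.inr (Sum.inr (Sum.inl (0, ⟨ℓ + 1, by omega⟩)))
  else Sum.inr (Sum.inr (Sum.inl (1, ⟨ℓ + 1, by omega⟩)))

/-- Attachment points of the three `ℓ`-edge paths: for both trees, paths `0` and `1` are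
attached at `x_ℓ` and `y_ℓ` (the parents of the two original leaves non-adjacent to the
root); path `2` is attached at the child `x_1` of `x` for `T_{2,ℓ}` (`three = false`)
and at `y = y_0` for `T_{3,ℓ}` (`three = true`). -/
def attachPt (ℓ : ℕ) (three : Bool) (p : Fin 3) : TVert ℓ :=
  if (p : ℕ) = 0 then Sum.inr (Sum.inr (Sum.inl (0, ⟨ℓ, by omega⟩)))
  else if (p : ℕ) = 1 then Sum.inr (Sum.inr (Sum.inl (1, ⟨ℓ, by omega⟩)))
  else if three then Sum.inr (Sum.inr (Sum.inl (1, ⟨0, by omega⟩)))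
  else Sum.inr (Sum.inr (Sum.inl (0, ⟨1, by omega⟩)))

/-- Base adjacency of `T_{2,ℓ}` (`three = false`) and `T_{3,ℓ}` (`three = true`). -/
def TAdj (ℓ : ℕ) (three : Bool) : TVert ℓ → TVert ℓ → Prop := fun a b =>
  match a, b with
  | Sum.inl _, Sum.inr (Sum.inl _) => True
  | Sum.inl _, Sum.inr (Sum.inr (Sum.inl p)) => (p.2 : ℕ) = 0
  | Sum.inr (Sum.inr (Sum.inl p)), Sum.inr (Sum.inr (Sum.inl q)) =>
      p.1 = q.1 ∧ (p.2 : ℕ) + 1 = (q.2 : ℕ)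
  | Sum.inr (Sum.inr (Sum.inr (Sum.inl p))), Sum.inr (Sum.inr (Sum.inr (Sum.inl q))) =>
      p.1 = q.1 ∧ (p.2 : ℕ) + 1 = (q.2 : ℕ)
  | Sum.inr (Sum.inr (Sum.inr (Sum.inr p))), Sum.inr (Sum.inr (Sum.inr (Sum.inr q))) =>
      p.1 = q.1 ∧ p.2.1 = q.2.1 ∧ (p.2.2 : ℕ) + 1 = (q.2.2 : ℕ)
  | x, Sum.inr (Sum.inr (Sum.inr (Sum.inl p))) => (p.2 : ℕ) = 0 ∧ x = attachPt ℓ three p.1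
  | x, Sum.inr (Sum.inr (Sum.inr (Sum.inr p))) => (p.2.2 : ℕ) = ℓ ∧ x = glueSite ℓ p.1
  | _, _ => False

/-- The tree `T_{2,ℓ}`. -/
def T2Graph (ℓ : ℕ) : SimpleGraph (TVert ℓ) := SimpleGraph.fromRel (TAdj ℓ false)

/-- The tree `T_{3,ℓ}`. -/
def T3Graph (ℓ : ℕ) : SimpleGraph (TVert ℓ) := SimpleGraph.fromRel (TAdj ℓ true)

/-- Disjoint union of two graphs. -/
def disjUnion (G : SimpleGraph V) (H : SimpleGraph W) : SimpleGraph (V ⊕ W) :=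
  SimpleGraph.fromRel (fun a b =>
    match a, b with
    | Sum.inl x, Sum.inl y => G.Adj x y
    | Sum.inr x, Sum.inr y => H.Adj x y
    | _, _ => False)

/-- Disjoint union of `m` copies of `G`. -/
def copies (m : ℕ) (G : SimpleGraph V) : SimpleGraph (Fin m × V) :=
  SimpleGraph.fromRel (fun a b => a.1 = b.1 ∧ G.Adj a.2 b.2)

/-- `T_{2,ℓ} ∪ ℓ·T_{1,ℓ}`. -/
def T2Union (ℓ : ℕ) : SimpleGraph (TVert ℓ ⊕ Fin ℓ × (Unit ⊕ Fin ℓ × Fin (2 * ℓ + 1))) :=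
  disjUnion (T2Graph ℓ) (copies ℓ (T1Graph ℓ))

/-- `T_{3,ℓ} ∪ ℓ·T_{1,ℓ}`. -/
def T3Union (ℓ : ℕ) : SimpleGraph (TVert ℓ ⊕ Fin ℓ × (Unit ⊕ Fin ℓ × Fin (2 * ℓ + 1))) :=
  disjUnion (T3Graph ℓ) (copies ℓ (T1Graph ℓ))

/-- Vertices of the infinite tree `T₁`. -/
abbrev T1InfVert : Type := Unit ⊕ ℕ ⊕ (ℕ × Fin 2 × ℕ)

/-- The infinite tree `T₁`: the root has countably many children, each child of the root
has exactly two children, and below these every vertex has exactly one child. -/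
def T1Inf : SimpleGraph T1InfVert :=
  SimpleGraph.fromRel (fun a b =>
    match a, b with
    | Sum.inl _, Sum.inr (Sum.inl _) => True
    | Sum.inr (Sum.inl i), Sum.inr (Sum.inr p) => i = p.1 ∧ p.2.2 = 0
    | Sum.inr (Sum.inr p), Sum.inr (Sum.inr q) =>
        p.1 = q.1 ∧ p.2.1 = q.2.1 ∧ p.2.2 + 1 = q.2.2
    | _, _ => False)

/-- A (finite) tree belongs to `𝒯₁` iff it is isomorphic to a connected induced
subgraph of `T₁`. -/
def MemT1Class (T : SimpleGraph W) : Prop :=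
  ∃ S : Set T1InfVert, (T1Inf.induce S).Connected ∧ Nonempty (T ≃g T1Inf.induce S)

/-- In a tree `T` rooted at `r`, `u` is a (not necessarily strict) ancestor of `v`. -/
def IsAncestor (T : SimpleGraph V) (r u v : V) : Prop :=
  ∃ p : T.Walk r v, p.IsPath ∧ u ∈ p.support

/-- The vertex set of the subtree of `T` (rooted at `r`) rooted at `x`. -/
def rootedSubtree (T : SimpleGraph V) (r x : V) : Set V := {v | IsAncestor T r x v}

/-- The set of vertices `x` whose rooted subtree contains a claw while no subtree rooted
at a strict descendant of `x` contains a claw. -/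
def clawMinimalSet (T : SimpleGraph V) (r : V) : Set V :=
  {x | (∃ A ⊆ rootedSubtree T r x, IsClawSet T A) ∧
    ∀ y, IsAncestor T r x y → y ≠ x → ¬ ∃ A ⊆ rootedSubtree T r y, IsClawSet T A}

/-- `z` is the least common ancestor of `x` and `y` in the tree `T` rooted at `r`. -/
def IsLCA (T : SimpleGraph V) (r x y z : V) : Prop :=
  IsAncestor T r z x ∧ IsAncestor T r z y ∧
    ∀ w, IsAncestor T r w x → IsAncestor T r w y → IsAncestor T r w z

/-- The set of least common ancestors of distinct pairs of `X`. -/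
def lcaSet (T : SimpleGraph V) (r : V) (X : Set V) : Set V :=
  {z | ∃ x ∈ X, ∃ y ∈ X, x ≠ y ∧ IsLCA T r x y z}

/-- `(G, S, L)` is a constellation: `S` is independent, the components of `G - S` are
exactly the paths of `L`, and every vertex of `S` has a neighbor on every path of `L`. -/
structure IsConstellation (G : SimpleGraph V) (S : Set V) (L : Set (Set V)) : Prop where
  indep : S.Pairwise fun x y => ¬ G.Adj x y
  pathsOffS : ∀ P ∈ L, Disjoint P S
  cover : ∀ v, v ∉ S → ∃ P ∈ L, v ∈ P
  pathsDisj : L.Pairwise fun P Q => Disjoint P Q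
  pathsNonempty : ∀ P ∈ L, P.Nonempty
  pathsArePaths : ∀ P ∈ L, IsPathGraph (G.induce P)
  pathsSep : ∀ P ∈ L, ∀ Q ∈ L, P ≠ Q → ∀ u ∈ P, ∀ v ∈ Q, ¬ G.Adj u v
  dominates : ∀ s ∈ S, ∀ P ∈ L, ∃ v ∈ P, G.Adj s v

/-- `(S, L)` has sizes `(s, p)`. -/
def IsSPConst (S : Set V) (L : Set (Set V)) (s p : ℕ) : Prop :=
  S.Finite ∧ S.ncard = s ∧ L.Finite ∧ L.ncard = p

/-- A `C`-route: a nontrivial path whose endpoints are in `S` and whose internal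
vertices avoid `S`. -/
def IsRoute (G : SimpleGraph V) (S : Set V) (x y : V) (p : G.Walk x y) : Prop :=
  x ∈ S ∧ y ∈ S ∧ p.IsPath ∧ 0 < p.length ∧
    ∀ v ∈ p.support, v ≠ x → v ≠ y → v ∉ S

/-- `d`-ample: no route with at most `d + 1` edges. -/
def IsAmple (G : SimpleGraph V) (S : Set V) (d : ℕ) : Prop :=
  ∀ (x y : V) (p : G.Walk x y), IsRoute G S x y p → d + 1 < p.length

/-- `e` is an endpoint of the path induced on `P`. -/
def IsPathEndpoint (G : SimpleGraph V) (P : Set V) (e : V) : Prop :=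
  e ∈ P ∧ {v | v ∈ P ∧ G.Adj e v}.ncard ≤ 1

/-- `d`-ample in the strengthened sense: additionally no vertex of `S` has a neighbor on
a path `P ∈ L` at distance (in `P`) less than `d` from an endpoint of `P`. -/
def IsAmpleStrong (G : SimpleGraph V) (S : Set V) (L : Set (Set V)) (d : ℕ) : Prop :=
  IsAmple G S d ∧
  ∀ s ∈ S, ∀ P ∈ L, ∀ (v : V) (hv : v ∈ P), G.Adj s v →
    ∀ (e : V) (he : e ∈ P), IsPathEndpoint G P e →
      d ≤ (G.induce P).dist ⟨v, hv⟩ ⟨e, he⟩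

/-- `r` is a strict total order on `S`. -/
def StrictTotalOrderOn (S : Set V) (r : V → V → Prop) : Prop :=
  (∀ x ∈ S, ¬ r x x) ∧
  (∀ x ∈ S, ∀ y ∈ S, ∀ z ∈ S, r x y → r y z → r x z) ∧
  (∀ x ∈ S, ∀ y ∈ S, x ≠ y → r x y ∨ r y x)

/-- Interrupted constellation: some total order on `S` such that for every `x ≺ y ≺ z`,
every route between `x` and `y` is adjacent to `z`. -/
def IsInterrupted (G : SimpleGraph V) (S : Set V) : Prop :=
  ∃ r : V → V → Prop, StrictTotalOrderOn S r ∧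
    ∀ x ∈ S, ∀ y ∈ S, ∀ z ∈ S, r x y → r y z →
      ∀ p : G.Walk x y, IsRoute G S x y p → ∃ v ∈ p.support, G.Adj z v

/-- `q`-zigzagged constellation: some total order on `S` such that for every route
between `x` and `y`, fewer than `q` vertices strictly between `x` and `y` have no
neighbor on the route. -/
def IsZigzagged (G : SimpleGraph V) (S : Set V) (q : ℕ) : Prop :=
  ∃ r : V → V → Prop, StrictTotalOrderOn S r ∧
    ∀ x ∈ S, ∀ y ∈ S, ∀ p : G.Walk x y, IsRoute G S x y p →
      {z | z ∈ S ∧ ((r x z ∧ r z y) ∨ (r y z ∧ r z x)) ∧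
        ∀ v ∈ p.support, ¬ G.Adj z v}.ncard < q

/-- Lift a subset of `V` to a subset of the subtype `↥U`. -/
def liftToSub (U : Set V) (T : Set V) : Set ↥U := {v : ↥U | (v : V) ∈ T}

/-- The graph `H'` obtained from `H` by adding a disjoint path on `2ℓ+1` vertices and
joining `u` to the center of this path. -/
def addPendantPath (H : SimpleGraph W) (u : W) (ℓ : ℕ) :
    SimpleGraph (W ⊕ Fin (2 * ℓ + 1)) :=
  SimpleGraph.fromRel (fun a b =>
    match a, b with
    | Sum.inl v, Sum.inl w => H.Adj v w
    | Sum.inl v, Sum.inr i => v = u ∧ (i : ℕ) = ℓ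
    | Sum.inr i, Sum.inr j => (i : ℕ) + 1 = (j : ℕ)
    | Sum.inr _, Sum.inl _ => False)

theorem aux_pathGraph_walk_le {n : ℕ} {i j : Fin n} (w : (pathGraph n).Walk i j) :
    i.val ≤ j.val + w.length ∧ j.val ≤ i.val + w.length := by
  induction w with
  | nil => simp
  | cons h q ih =>
    rw [pathGraph_adj] at h
    simp only [Walk.length_cons]
    omega

theorem aux_pathGraph_exists_walk {n : ℕ} (k : ℕ) : ∀ (i j : Fin n), i.val + k = j.val →
    ∃ w : (pathGraph n).Walk i j, w.length = k := by
  induction k with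
  | zero =>
    intro i j h
    have : i = j := Fin.ext (by omega)
    subst this
    exact ⟨Walk.nil, rfl⟩
  | succ k ih =>
    intro i j h
    have hj := j.isLt
    obtain ⟨w, hw⟩ := ih ⟨i.val + 1, by omega⟩ j (by simp only; omega)
    have hadj : (pathGraph n).Adj i ⟨i.val + 1, by omega⟩ := by
      rw [pathGraph_adj]; left; rfl
    exact ⟨Walk.cons hadj w, by simp [hw]⟩

theorem aux_path_in {G : SimpleGraph V} {P : Set V} {n : ℕ}
    (φ : G.induce P ≃g pathGraph n) (u v : P) (h : (φ u).val ≤ (φ v).val) :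
    ∃ w : (G.induce P).Walk u v, w.IsPath ∧ w.length ≤ (φ v).val - (φ u).val := by
  classical
  obtain ⟨w, hw⟩ := aux_pathGraph_exists_walk ((φ v).val - (φ u).val) (φ u) (φ v) (by omega)
  let w' : (G.induce P).Walk u v := (w.map φ.symm.toHom).copy (by simp) (by simp)
  refine ⟨w'.bypass, w'.bypass_isPath, w'.length_bypass_le_length.trans ?_⟩
  simp [w', hw]

theorem aux_route {G : SimpleGraph V} {SC P : Set V} {d n : ℕ} (hA : IsAmple G SC d)
    (hdis : Disjoint P SC) (φ : G.induce P ≃g pathGraph n) {x y : V} (hx : x ∈ SC)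
    (hy : y ∈ SC) (hxy : x ≠ y) (u v : P) (hxu : G.Adj x u) (hyv : G.Adj y v)
    (hle : (φ u).val ≤ (φ v).val) (hlt : (φ v).val < (φ u).val + d) : False := by
  obtain ⟨w, hwp, hwl⟩ := aux_path_in φ u v hle
  have hoff : ∀ z ∈ P, z ∉ SC := fun z hz hz' => Set.disjoint_left.mp hdis hz hz'
  let q : G.Walk (u : V) (v : V) := w.map (Embedding.induce P).toHom
  have hq : q.IsPath := hwp.map Subtype.val_injective
  have hqs : ∀ z ∈ q.support, z ∈ P := by
    intro z hz
    have hz' : z ∈ (w.map (Embedding.induce P).toHom).support := hz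
    rw [Walk.support_map, List.mem_map] at hz'
    obtain ⟨a, _, rfl⟩ := hz'
    exact a.2
  have hql : q.length = w.length := Walk.length_map _ _
  have hc : (q.concat hyv.symm).IsPath :=
    (Walk.concat_isPath_iff _).mpr ⟨hq, fun h => hoff _ (hqs _ h) hy⟩
  have hr := hA x y (Walk.cons hxu (q.concat hyv.symm)) ⟨hx, hy, ?_, ?_, ?_⟩
  · simp only [Walk.length_cons, Walk.length_concat, hql] at hr
    omega
  · rw [Walk.cons_isPath_iff]
    refine ⟨hc, ?_⟩
    rw [Walk.support_concat]
    simp only [List.mem_append, List.mem_singleton, not_or]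
    exact ⟨fun h => hoff _ (hqs _ h) hx, hxy⟩
  · simp
  · intro z hz hzx hzy
    rw [Walk.support_cons, Walk.support_concat] at hz
    simp only [List.mem_cons, List.mem_append] at hz
    rcases hz with h | h | h
    · exact absurd h hzx
    · exact hoff _ (hqs _ h)
    · simp at h; exact absurd h hzy

theorem aux_route' {G : SimpleGraph V} {SC P : Set V} {d n : ℕ} (hA : IsAmple G SC d)
    (hdis : Disjoint P SC) (φ : G.induce P ≃g pathGraph n) {x y : V} (hx : x ∈ SC)
    (hy : y ∈ SC) (u v : P) (hxu : G.Adj x u) (hyv : G.Adj y v)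
    (h1 : (φ u).val < (φ v).val + d) (h2 : (φ v).val < (φ u).val + d) : x = y := by
  by_contra hxy
  rcases le_total (φ u).val (φ v).val with h | h
  · exact aux_route hA hdis φ hx hy hxy u v hxu hyv h h2
  · exact aux_route hA hdis φ hy hx (Ne.symm hxy) v u hyv hxu h h1

theorem aux_endpoint {G : SimpleGraph V} {P : Set V} {n : ℕ}
    (φ : G.induce P ≃g pathGraph n) (e : V) (he : e ∈ P) (h : IsPathEndpoint G P e) :
    (φ ⟨e, he⟩).val = 0 ∨ (φ ⟨e, he⟩).val + 1 = n := by
  by_contra! hcon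
  obtain ⟨h0, h1⟩ := hcon
  have hlt := (φ ⟨e, he⟩).isLt
  have hPfin : P.Finite := (Set.finite_coe_iff).mp (Finite.of_equiv _ φ.symm.toEquiv)
  have hfin : {v | v ∈ P ∧ G.Adj e v}.Finite := hPfin.subset fun v hv => hv.1
  let a : P := φ.symm ⟨(φ ⟨e, he⟩).val - 1, by omega⟩
  let b : P := φ.symm ⟨(φ ⟨e, he⟩).val + 1, by omega⟩
  have ha : (G.induce P).Adj ⟨e, he⟩ a := by
    have hφ : (φ a).val = (φ ⟨e, he⟩).val - 1 := by simp [a]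
    rw [← φ.map_adj_iff, pathGraph_adj]
    omega
  have hb : (G.induce P).Adj ⟨e, he⟩ b := by
    have hφ : (φ b).val = (φ ⟨e, he⟩).val + 1 := by simp [b]
    rw [← φ.map_adj_iff, pathGraph_adj]
    omega
  have hab : (a : V) ≠ b := by
    intro hab
    have := φ.symm.injective (Subtype.ext hab)
    simp only [Fin.mk.injEq] at this
    omega
  have := (Set.one_lt_ncard hfin).mpr ⟨a, ⟨a.2, ha⟩, b, ⟨b.2, hb⟩, hab⟩
  have := h.2
  omega

theorem aux_dist {G : SimpleGraph V} {P : Set V} {n d : ℕ}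
    (φ : G.induce P ≃g pathGraph n) (v e : P) (he : IsPathEndpoint G P e)
    (h1 : d ≤ (φ v).val) (h2 : (φ v).val + d < n) :
    d ≤ (G.induce P).dist v e := by
  have hr : (G.induce P).Reachable v e := by
    rw [← φ.reachable_iff]
    exact pathGraph_preconnected n _ _
  obtain ⟨w, hw⟩ := hr.exists_walk_length_eq_dist
  have := aux_pathGraph_walk_le (w.map φ.toHom)
  simp only [Walk.length_map, hw] at this
  have this' : (φ v).val ≤ (φ e).val + (G.induce P).dist v e ∧
    (φ e).val ≤ (φ v).val + (G.induce P).dist v e := this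
  have h3 := aux_endpoint φ e e.2 he
  simp only [Subtype.coe_eta] at h3
  omega

/-- Inducing twice. -/
def auxIso (G : SimpleGraph V) (U P : Set V) (h : P ⊆ U) :
    (G.induce U).induce (liftToSub U P) ≃g G.induce P where
  toFun x := ⟨x.1.1, x.2⟩
  invFun x := ⟨⟨x.1, h x.2⟩, x.2⟩
  left_inv _ := rfl
  right_inv _ := rfl
  map_rel_iff' := Iff.rfl

theorem statement2 (s p d : ℕ) (hs : 1 ≤ s) (hp : 1 ≤ p) (hd : 1 ≤ d)
    (V : Type) (G : SimpleGraph V) (SC : Set V) (LC : Set (Set V))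
    (hC : IsConstellation G SC LC) (hsp : IsSPConst SC LC (s + 2 * p) p)
    (hA : IsAmple G SC d) :
    ∃ S : Set V, S ⊆ SC ∧ S.ncard = s ∧
      IsConstellation (G.induce (S ∪ ⋃₀ LC)) (liftToSub (S ∪ ⋃₀ LC) S)
        (liftToSub (S ∪ ⋃₀ LC) '' LC) ∧
      IsSPConst (liftToSub (S ∪ ⋃₀ LC) S) (liftToSub (S ∪ ⋃₀ LC) '' LC) s p ∧
      IsAmpleStrong (G.induce (S ∪ ⋃₀ LC)) (liftToSub (S ∪ ⋃₀ LC) S)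
        (liftToSub (S ∪ ⋃₀ LC) '' LC) d := by
  classical
  obtain ⟨hSf, hSn, hLf, hLn⟩ := hsp
  have hpath : ∀ P : Set V, ∃ n : ℕ, P ∈ LC → Nonempty (G.induce P ≃g pathGraph n) := by
    intro P
    by_cases hP : P ∈ LC
    · obtain ⟨n, hn⟩ := hC.pathsArePaths P hP
      exact ⟨n, fun _ => hn⟩
    · exact ⟨0, fun h => absurd h hP⟩
  choose N hN using hpath
  let φ : ∀ P : Set V, P ∈ LC → (G.induce P ≃g pathGraph (N P)) := fun P hP => (hN P hP).some
  let B1 : Set V → Set V := fun P =>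
    {x | x ∈ SC ∧ ∃ (hP : P ∈ LC) (v : P), G.Adj x v ∧ (φ P hP v).val < d}
  let B2 : Set V → Set V := fun P =>
    {x | x ∈ SC ∧ ∃ (hP : P ∈ LC) (v : P), G.Adj x v ∧ N P ≤ (φ P hP v).val + d}
  have hB1 : ∀ P, (B1 P).ncard ≤ 1 := by
    intro P
    refine (Set.ncard_le_one (hSf.subset fun x hx => hx.1)).mpr ?_
    rintro x ⟨hx, hP, u, hu, hu'⟩ y ⟨hy, _, v, hv, hv'⟩
    exact aux_route' hA (hC.pathsOffS P hP) (φ P hP) hx hy u v hu hv (by omega) (by omega)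
  have hB2 : ∀ P, (B2 P).ncard ≤ 1 := by
    intro P
    refine (Set.ncard_le_one (hSf.subset fun x hx => hx.1)).mpr ?_
    rintro x ⟨hx, hP, u, hu, hu'⟩ y ⟨hy, _, v, hv, hv'⟩
    have h1 := (φ P hP u).isLt
    have h2 := (φ P hP v).isLt
    exact aux_route' hA (hC.pathsOffS P hP) (φ P hP) hx hy u v hu hv (by omega) (by omega)
  let Bad : Set V := ⋃ P ∈ hLf.toFinset, (B1 P ∪ B2 P)
  have hBadSub : Bad ⊆ SC := by
    intro x hx
    simp only [Bad, Set.mem_iUnion] at hx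
    obtain ⟨P, _, h | h⟩ := hx
    · exact h.1
    · exact h.1
  have hBad : Bad.ncard ≤ 2 * p := by
    calc Bad.ncard ≤ ∑ P ∈ hLf.toFinset, (B1 P ∪ B2 P).ncard := Finset.set_ncard_biUnion_le _ _
      _ ≤ ∑ P ∈ hLf.toFinset, 2 := Finset.sum_le_sum fun P _ =>
          (Set.ncard_union_le _ _).trans (by have := hB1 P; have := hB2 P; omega)
      _ = 2 * p := by
          rw [Finset.sum_const, ← Set.ncard_eq_toFinset_card _ hLf, hLn, smul_eq_mul, mul_comm]
  have hge : s ≤ (SC \ Bad).ncard := by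
    have := Set.le_ncard_sdiff Bad SC (hSf.subset hBadSub)
    omega
  obtain ⟨S, hSsub, hScard⟩ := Set.exists_subset_card_eq hge
  have hSSC : S ⊆ SC := fun x hx => (hSsub hx).1
  have hgood : ∀ x ∈ S, ∀ P (hP : P ∈ LC) (v : P), G.Adj x v →
      d ≤ (φ P hP v).val ∧ (φ P hP v).val + d < N P := by
    intro x hx P hP v hv
    have hnb := (hSsub hx).2
    simp only [Bad, Set.mem_iUnion, not_exists] at hnb
    have hnb' := hnb P (by simpa using hP)
    constructor
    · by_contra hcon
      exact hnb' (Or.inl ⟨hSSC hx, hP, v, hv, by omega⟩)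
    · by_contra hcon
      exact hnb' (Or.inr ⟨hSSC hx, hP, v, hv, by omega⟩)
  have hPU : ∀ P ∈ LC, P ⊆ S ∪ ⋃₀ LC := fun P hP x hx => Or.inr ⟨P, hP, hx⟩
  have hSU : S ⊆ S ∪ ⋃₀ LC := fun x hx => Or.inl hx
  refine ⟨S, hSSC, hScard, ?_⟩
  generalize hU : S ∪ ⋃₀ LC = U at hPU hSU ⊢
  have hUmem : ∀ x ∈ U, x ∈ S ∨ ∃ P ∈ LC, x ∈ P := by
    intro x hx; rw [← hU] at hx; exact hx
  have hUSC : ∀ x ∈ U, x ∈ SC → x ∈ S := by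
    intro x hx hx'
    rcases hUmem x hx with h | ⟨P, hP, h⟩
    · exact h
    · exact absurd hx' (Set.disjoint_left.mp (hC.pathsOffS P hP) h)
  refine ⟨?_, ?_, ?_, ?_⟩
  · constructor
    · intro x hx y hy hxy
      exact hC.indep (hSSC hx) (hSSC hy) (fun h => hxy (Subtype.ext h))
    · rintro _ ⟨P, hP, rfl⟩
      exact Set.disjoint_left.mpr fun x hx hx' =>
        Set.disjoint_left.mp (hC.pathsOffS P hP) hx (hSSC hx')
    · intro x hx
      rcases hUmem x x.2 with h | ⟨P, hP, h⟩
      · exact absurd h hx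
      · exact ⟨_, ⟨P, hP, rfl⟩, h⟩
    · rintro _ ⟨P, hP, rfl⟩ _ ⟨Q, hQ, rfl⟩ hne
      have hPQ : P ≠ Q := fun h => hne (by rw [h])
      exact Set.disjoint_left.mpr fun x hx hx' =>
        Set.disjoint_left.mp (hC.pathsDisj hP hQ hPQ) hx hx'
    · rintro _ ⟨P, hP, rfl⟩
      obtain ⟨x, hx⟩ := hC.pathsNonempty P hP
      exact ⟨⟨x, hPU P hP hx⟩, hx⟩
    · rintro _ ⟨P, hP, rfl⟩
      exact ⟨N P, ⟨(auxIso G U P (hPU P hP)).trans (φ P hP)⟩⟩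
    · rintro _ ⟨P, hP, rfl⟩ _ ⟨Q, hQ, rfl⟩ hne u hu v hv
      have hPQ : P ≠ Q := fun h => hne (by rw [h])
      exact hC.pathsSep P hP Q hQ hPQ u hu v hv
    · rintro x hx _ ⟨P, hP, rfl⟩
      obtain ⟨v, hv, hxv⟩ := hC.dominates x (hSSC hx) P hP
      exact ⟨⟨v, hPU P hP hv⟩, hv, hxv⟩
  · have himg : ∀ T : Set V, T ⊆ U → Subtype.val '' (liftToSub U T) = T := by
      intro T hT
      ext x
      constructor
      · rintro ⟨y, hy, rfl⟩; exact hy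
      · intro hx; exact ⟨⟨x, hT hx⟩, hx, rfl⟩
    refine ⟨?_, ?_, hLf.image _, ?_⟩
    · exact (hSf.subset hSSC).preimage Subtype.val_injective.injOn
    · rw [← hScard]
      conv_rhs => rw [← himg S hSU]
      rw [Set.ncard_image_of_injective _ Subtype.val_injective]
    · rw [← hLn]
      refine Set.InjOn.ncard_image ?_
      intro P hP Q hQ hPQ
      rw [← himg P (hPU P hP), ← himg Q (hPU Q hQ), hPQ]
  · rintro x y q ⟨hx, hy, hq, hl, hint⟩
    have := hA _ _ (q.map (Embedding.induce U).toHom) ⟨hSSC hx, hSSC hy, ?_, ?_, ?_⟩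
    · rwa [Walk.length_map] at this
    · exact hq.map Subtype.val_injective
    · rwa [Walk.length_map]
    · intro v hv hvx hvy hvS
      rw [Walk.support_map, List.mem_map] at hv
      obtain ⟨a, ha, rfl⟩ := hv
      exact hint a ha (fun h => hvx (by rw [h])) (fun h => hvy (by rw [h]))
        (hUSC _ a.2 hvS)
  · rintro x hx _ ⟨P, hP, rfl⟩ v hv hxv e he hend
    have hg := hgood x hx P hP ⟨v.1, hv⟩ hxv
    exact aux_dist ((auxIso G U P (hPU P hP)).trans (φ P hP)) ⟨v, hv⟩ ⟨e, he⟩ hend hg.1 hg.2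

end Paper
end

section
/- Let H be a graph and let A, B, C ⊆ V(H) be three nonempty sets such that for every X ∈ {A, B, C}: (1) N_H[X] is disjoint from both sets in {A, B, C} \ {X}; (2) H[X] is connected and is not a path; (3) the two sets in {A, B, C} \ {X} lie in the same connected component of H − N_H[X]. Then for every positive integer n, H is not an induced minor of the n × n Pohoata–Davies grid. -/
open SimpleGraph

namespace Paper

variable {V W : Type*}

theorem conn_prop {U : Type*} (G : SimpleGraph U) (S : Set U) (hS : (G.induce S).Connected)
    (P : U → Prop) (hP : ∀ a ∈ S, ∀ b ∈ S, G.Adj a b → P a → P b)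
    (p q : U) (hp : p ∈ S) (hq : q ∈ S) (hpp : P p) : P q := by
  obtain ⟨w⟩ := hS.preconnected ⟨p, hp⟩ ⟨q, hq⟩
  have key : ∀ (x y : S) (w : (G.induce S).Walk x y), P x.1 → P y.1 := by
    intro x y w
    induction w with
    | nil => exact id
    | @cons a b c hadj _ ih => exact fun ha => ih (hP _ a.2 _ b.2 hadj ha)
  exact key _ _ w hpp

theorem isPath_of_order {U : Type*} [Finite U] (G : SimpleGraph U) (hG : G.Connected)
    (f : U → ℕ) (hf : Function.Injective f)
    (hadj : ∀ u v, G.Adj u v → f u < f v → ∀ w, f u < f w → f w < f v → False) :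
    IsPathGraph G := by
  classical
  haveI := Fintype.ofFinite U
  letI : LinearOrder U := LinearOrder.lift' f hf
  have hlt : ∀ a b : U, a < b ↔ f a < f b := fun a b => Iff.rfl
  have hcov : ∀ u v, G.Adj u v → f u < f v → u ⋖ v := by
    intro u v h1 h2
    exact ⟨h2, fun w hw hw' => hadj u v h1 h2 w hw hw'⟩
  have hcov' : ∀ u v : U, u ⋖ v → G.Adj u v := by
    intro u v huv
    by_contra hn
    have hlt' : f u < f v := huv.1
    have : f v ≤ f u := by
      obtain ⟨w⟩ := hG.preconnected u v
      have key : ∀ (x y : U) (w : G.Walk x y), f x ≤ f u → f y ≤ f u := by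
        intro x y w
        induction w with
        | nil => exact id
        | @cons a b c hab _ ih =>
          intro ha
          apply ih
          by_contra hb
          push Not at hb
          have hab' : f a < f b := by omega
          have c1 := hcov a b hab hab'
          have hau : a = u := by
            by_contra hne
            have : f a ≠ f u := fun h => hne (hf h)
            exact hadj a b hab hab' u (by omega) hb
          subst hau
          have hbv : b = v := by
            by_contra hne
            have h3 : f b ≠ f v := fun h => hne (hf h)
            rcases lt_or_gt_of_ne h3 with h4 | h4
            · exact huv.2 (c := b) hb h4
            · exact hadj a b hab hab' v hlt' h4
          subst hbv
          exact hn hab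
      exact key u v w le_rfl
    omega
  let e : Fin (Fintype.card U) ≃o U := Fintype.orderIsoFinOfCardEq U rfl
  refine ⟨Fintype.card U, ⟨⟨e.symm.toEquiv, ?_⟩⟩⟩
  intro a b
  show (hasse _).Adj (e.symm a) (e.symm b) ↔ _
  rw [hasse_adj, apply_covBy_apply_iff, apply_covBy_apply_iff]
  constructor
  · rintro (h | h)
    · exact hcov' _ _ h
    · exact (hcov' _ _ h).symm
  · intro h
    have hne : f a ≠ f b := fun h' => h.ne (hf h')
    rcases lt_or_gt_of_ne hne with h4 | h4
    · exact Or.inl (hcov _ _ h h4)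
    · exact Or.inr (hcov _ _ h.symm h4)

/-- Column of a vertex of the grid. -/
def pdCol {n : ℕ} : Fin n × Fin n ⊕ Fin n → ℕ
  | Sum.inl p => p.2
  | Sum.inr s => s

theorem pdCol_adj {n : ℕ} {a b : Fin n × Fin n ⊕ Fin n} (h : (pdGrid n).Adj a b) :
    pdCol a ≤ pdCol b + 1 ∧ pdCol b ≤ pdCol a + 1 := by
  rcases a with ⟨a1, a2⟩ | a <;> rcases b with ⟨b1, b2⟩ | b <;>
    simp [pdGrid, pdCol, SimpleGraph.fromRel_adj] at h ⊢
  · omega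
  · subst h; omega
  · subst h; omega

theorem pd_row {n : ℕ} {p q : Fin n × Fin n} (h : (pdGrid n).Adj (Sum.inl p) (Sum.inl q)) :
    p.1 = q.1 ∧ (pdCol (Sum.inl p : Fin n × Fin n ⊕ Fin n) + 1 = pdCol (Sum.inl q : Fin n × Fin n ⊕ Fin n) ∨
      pdCol (Sum.inl q : Fin n × Fin n ⊕ Fin n) + 1 = pdCol (Sum.inl p : Fin n × Fin n ⊕ Fin n)) := by
  simp only [pdGrid, pdCol, SimpleGraph.fromRel_adj] at h ⊢
  rcases h.2 with h | h
  · exact ⟨h.1, Or.inl h.2⟩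
  · exact ⟨h.1.symm, Or.inr h.2⟩

theorem pd_star {n : ℕ} {x : Fin n × Fin n ⊕ Fin n} {s : Fin n} (h : pdCol x = s) :
    x = Sum.inr s ∨ (pdGrid n).Adj x (Sum.inr s) := by
  rcases x with ⟨p1, p2⟩ | t
  · right
    simp [pdGrid, pdCol, SimpleGraph.fromRel_adj] at h ⊢
    exact Fin.ext h
  · left
    simp [pdCol] at h
    rw [Fin.ext h]

theorem pd_ivt {n : ℕ} (S : Set (Fin n × Fin n ⊕ Fin n)) (hS : ((pdGrid n).induce S).Connected)
    (k : ℕ) (p q) (hp : p ∈ S) (hq : q ∈ S) (h1 : pdCol p ≤ k) (h2 : k ≤ pdCol q) :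
    ∃ r ∈ S, pdCol r = k := by
  by_contra hn
  push Not at hn
  have := conn_prop _ S hS (fun x => pdCol x < k) (by
    intro a ha b hb hab h
    have := pdCol_adj hab
    have := hn b hb
    show pdCol b < k
    have h : pdCol a < k := h
    omega) p q hp hq (lt_of_le_of_ne h1 (hn p hp))
  have : pdCol q < k := this
  omega

theorem exists_star {V : Type} [Finite V] (H : SimpleGraph V) (n : ℕ)
    (M : V → Set (Fin n × Fin n ⊕ Fin n)) (hM : IsInducedMinorModel H (pdGrid n) M)
    (X : Set V) (hc : (H.induce X).Connected) (hnp : ¬ IsPathGraph (H.induce X)) :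
    ∃ s : Fin n, ∃ v ∈ X, Sum.inr s ∈ M v := by
  by_contra hno
  push Not at hno
  obtain ⟨hne, hconn, hdisj, hadj⟩ := hM
  apply hnp
  have hpath : ∀ v ∈ X, ∀ x ∈ M v, ∃ p, x = Sum.inl p := by
    intro v hv x hx
    rcases x with p | s
    · exact ⟨p, rfl⟩
    · exact absurd hx (hno s v hv)
  obtain ⟨⟨v0, hv0⟩⟩ := hc.nonempty
  obtain ⟨x0, hx0⟩ := hne v0
  obtain ⟨p0, rfl⟩ := hpath v0 hv0 x0 hx0
  have hin : ∀ v ∈ X, ∀ p ∈ M v, (∃ r, p = Sum.inl r ∧ r.1 = p0.1) → ∀ q ∈ M v,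
      ∃ r, q = Sum.inl r ∧ r.1 = p0.1 := by
    intro v hv p hp hpr q hq
    refine conn_prop _ (M v) (hconn v) (fun q => ∃ r, q = Sum.inl r ∧ r.1 = p0.1) ?_ p q hp hq hpr
    rintro a ha b hb hab ⟨r, rfl, hr⟩
    obtain ⟨b, rfl⟩ := hpath v hv b hb
    exact ⟨b, rfl, (pd_row hab).1 ▸ hr⟩
  have hrow : ∀ v ∈ X, ∀ q ∈ M v, ∃ r, q = Sum.inl r ∧ r.1 = p0.1 := by
    intro v hv
    refine conn_prop H X hc (fun v => ∀ q ∈ M v, ∃ r, q = Sum.inl r ∧ r.1 = p0.1) ?_ v0 v hv0 hv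
      (hin v0 hv0 _ hx0 ⟨p0, rfl, rfl⟩)
    intro a ha b hb hab h
    obtain ⟨x, hx, y, hy, hxy⟩ := (hadj a b hab.ne).2 hab
    apply hin b hb y hy
    obtain ⟨r, rfl, hr⟩ := h x hx
    obtain ⟨y, rfl⟩ := hpath b hb y hy
    exact ⟨y, rfl, (pd_row hxy).1 ▸ hr⟩
  have huniq : ∀ u ∈ X, ∀ v ∈ X, ∀ x ∈ M u, ∀ y ∈ M v, pdCol x = pdCol y → u = v := by
    intro u hu v hv x hx y hy hxy
    by_contra huv
    obtain ⟨r, rfl, hr⟩ := hrow u hu x hx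
    obtain ⟨r', rfl, hr'⟩ := hrow v hv y hy
    have : r = r' := Prod.ext (hr.trans hr'.symm) (Fin.ext hxy)
    subst this
    exact Set.disjoint_left.1 (hdisj huv) hx hy
  choose g hg using hne
  have hbet : ∀ u ∈ X, ∀ v ∈ X, ∀ x ∈ M u, ∀ x' ∈ M u, ∀ y ∈ M v, pdCol x ≤ pdCol y →
      pdCol y ≤ pdCol x' → u = v := by
    intro u hu v hv x hx x' hx' y hy h1 h2
    obtain ⟨r, hr, hr'⟩ := pd_ivt (M u) (hconn u) _ x x' hx hx' h1 h2
    exact huniq u hu v hv r hr y hy hr'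
  apply isPath_of_order (H.induce X) hc (fun v => pdCol (g v.1))
  · intro u v h
    exact Subtype.ext (huniq _ u.2 _ v.2 _ (hg _) _ (hg _) h)
  · rintro ⟨u, hu⟩ ⟨v, hv⟩ huv hlt ⟨w, hw⟩ h1 h2
    have huv : H.Adj u v := huv
    obtain ⟨x, hx, y, hy, hxy⟩ := (hadj u v huv.ne).2 huv
    simp only at hlt h1 h2
    have hwu : u ≠ w := by rintro rfl; omega
    have hwv : v ≠ w := by rintro rfl; omega
    have e1 := hbet u hu w hw _ (hg u) x hx _ (hg w)
    have e2 := hbet v hv w hw y hy _ (hg v) _ (hg w)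
    have := pdCol_adj hxy
    have n1 : ¬ pdCol (g w) ≤ pdCol x := fun h => hwu (e1 h1.le h)
    have n2 : ¬ pdCol y ≤ pdCol (g w) := fun h => hwv (e2 h h2.le)
    omega

theorem cross {V : Type} (H : SimpleGraph V) (n : ℕ)
    (M : V → Set (Fin n × Fin n ⊕ Fin n)) (hM : IsInducedMinorModel H (pdGrid n) M)
    (X : Set V) (s : Fin n) (x : V) (hx : x ∈ X) (hs : Sum.inr s ∈ M x)
    (u v : V) (w : H.Walk u v) (hw : ∀ y ∈ w.support, y ∉ closedNbhd H X)
    (a b) (ha : a ∈ M u) (hb : b ∈ M v) (has : pdCol a < s) : pdCol b < s := by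
  obtain ⟨hne, hconn, hdisj, hadj⟩ := hM
  have hcol : ∀ y, y ∉ closedNbhd H X → ∀ p ∈ M y, pdCol p ≠ s := by
    intro y hy p hp hps
    apply hy
    by_cases hxy : x = y
    · exact Or.inl (hxy ▸ hx)
    · rcases pd_star hps with rfl | h
      · exact absurd hp (Set.disjoint_left.1 (hdisj hxy) hs)
      · exact Or.inr ⟨x, hx, (hadj x y hxy).1 ⟨_, hs, p, hp, h.symm⟩⟩
  have hside : ∀ y, y ∉ closedNbhd H X → ∀ p ∈ M y, pdCol p < s → ∀ q ∈ M y, pdCol q < s := by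
    intro y hy p hp hps q hq
    refine conn_prop _ (M y) (hconn y) (fun q => pdCol q < s) ?_ p q hp hq hps
    intro c hc d hd hcd h
    have h : pdCol c < s := h
    have := pdCol_adj hcd
    have := hcol y hy d hd
    show pdCol d < s
    omega
  induction w generalizing a with
  | nil => exact hside _ (hw _ (by simp)) a ha has b hb
  | @cons c d e hcd w ih =>
    obtain ⟨p, hp, q, hq, hpq⟩ := (hadj c d hcd.ne).2 hcd
    have hc := hw c (by simp)
    have hd := hw d (by simp)
    have h1 := hside c hc a ha has p hp
    have h2 := pdCol_adj hpq
    have h3 := hcol d hd q hq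
    exact ih (fun y hy => hw y (by simp [hy])) q hq hb (by omega)

theorem middle (s : Fin 3 → ℕ) (hs : ∀ i j, i ≠ j → s i ≠ s j) :
    ∃ i j k : Fin 3, j ≠ i ∧ k ≠ i ∧ s j < s i ∧ s i < s k := by
  have h01 := hs 0 1 (by decide)
  have h02 := hs 0 2 (by decide)
  have h12 := hs 1 2 (by decide)
  by_cases a : s 0 < s 1 <;> by_cases b : s 1 < s 2 <;> by_cases c : s 0 < s 2
  · exact ⟨1, 0, 2, by decide, by decide, by omega, by omega⟩
  · omega
  · exact ⟨2, 0, 1, by decide, by decide, by omega, by omega⟩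
  · exact ⟨0, 2, 1, by decide, by decide, by omega, by omega⟩
  · exact ⟨0, 1, 2, by decide, by decide, by omega, by omega⟩
  · exact ⟨2, 1, 0, by decide, by decide, by omega, by omega⟩
  · omega
  · exact ⟨1, 2, 0, by decide, by decide, by omega, by omega⟩

theorem statement3 (V : Type) [Fintype V] (H : SimpleGraph V) (A B C : Set V)
    (h : NpdConfig H A B C) :
    ∀ n : ℕ, 1 ≤ n → ¬ InducedMinor H (pdGrid n) := by
  rintro n - ⟨M, hM⟩
  obtain ⟨-, -, -, h⟩ := h
  have hst := fun i => exists_star H n M hM (pick3 A B C i) (h i).2.1 (h i).2.2.1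
  choose s v hv hs using hst
  obtain ⟨i, j, k, hji, hki, h1, h2⟩ := middle (fun i => (s i : ℕ)) (by
    intro i j hij he
    have he : s i = s j := Fin.ext he
    have hvv : v i ≠ v j := by
      intro hvv
      refine Set.disjoint_left.1 ((h i).1 j hij.symm) (Or.inl (hv i)) ?_
      rw [hvv]
      exact hv j
    have h3 := hs i
    rw [he] at h3
    exact Set.disjoint_left.1 (hM.2.2.1 hvv) h3 (hs j))
  obtain ⟨w, hw⟩ := (h i).2.2.2 j k hji hki _ (hv j) _ (hv k)
  have := cross H n M hM (pick3 A B C i) (s i) (v i) (hv i) (hs i) _ _ w hw _ _ (hs j) (hs k) h1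
  have : (s k : ℕ) < s i := this
  omega

end Paper
end

section
/- Every finite tree that does not belong to 𝒯₁ contains two vertex-disjoint claws. -/
open SimpleGraph

namespace Paper

variable {V W : Type*}

/-- Rooted structure on a tree. -/
structure Rooted (T : SimpleGraph V) (r : V) (d : V → ℕ) (p : V → V) : Prop where
  d0 : ∀ v, d v = 0 ↔ v = r
  dp : ∀ v, v ≠ r → d (p v) + 1 = d v
  adj : ∀ u v, T.Adj u v ↔ (u ≠ r ∧ p u = v) ∨ (v ≠ r ∧ p v = u)

theorem exists_rooted (T : SimpleGraph V) (hT : T.IsTree) (r : V) :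
    ∃ d p, Rooted T r d p := by
  classical
  have hex : ∀ v, ∃ w, v ≠ r → (T.Adj w v ∧ T.dist r w + 1 = T.dist r v ∧
      ∀ w', T.Adj w' v → T.dist r w' + 1 = T.dist r v → w' = w) := by
    intro v
    obtain ⟨P, hP, hPl⟩ := (hT.connected r v).exists_path_of_dist
    refine ⟨P.penultimate, fun hv => ?_⟩
    have key : ∀ w', T.Adj w' v → T.dist r w' + 1 = T.dist r v → w' = P.penultimate := by
      intro w' hw' hd
      obtain ⟨Q, hQ, hQl⟩ := (hT.connected r w').exists_path_of_dist
      have h1 : v ∉ Q.support := by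
        intro hmem
        have := hT.isAcyclic.path_concat hP hQ hw'.symm hmem
        have h2 := congrArg Walk.length this
        rw [Walk.length_concat] at h2
        omega
      have h2 := hT.isAcyclic.mem_support_of_ne_mem_support_of_adj_of_isPath hP hQ hw'.symm h1
      exact hT.isAcyclic.eq_penultimate_of_adj_end hP hw'.symm h2
    have hnn : ¬ P.Nil := fun h => hv h.eq.symm
    have hadj := P.adj_penultimate hnn
    refine ⟨hadj, ?_, key⟩
    have h3 := hT.dist_eq_dist_add_one_of_adj r hadj
    have h4 : T.dist r P.penultimate ≤ P.length - 1 := by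
      have := SimpleGraph.dist_le P.dropLast
      simpa using this
    omega
  choose p hp using hex
  refine ⟨T.dist r, p, ?_, fun v hv => (hp v hv).2.1, ?_⟩
  · intro v
    rw [hT.connected.dist_eq_zero_iff]
    exact eq_comm
  · intro u v
    have hr : T.dist r r = 0 := by simp
    constructor
    · intro h
      have h3 := hT.dist_eq_dist_add_one_of_adj r h
      rcases h3 with h3 | h3
      · left
        have hu : u ≠ r := by rintro rfl; omega
        exact ⟨hu, ((hp u hu).2.2 v h.symm h3.symm).symm⟩
      · right
        have hu : v ≠ r := by rintro rfl; omega
        exact ⟨hu, ((hp v hu).2.2 u h h3.symm).symm⟩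
    · rintro (⟨h, rfl⟩ | ⟨h, rfl⟩)
      · exact (hp u h).1.symm
      · exact (hp v h).1

/-- Four vertices forming a claw with center `c`. -/
def Claw4 (T : SimpleGraph V) (c x y z : V) : Prop :=
  T.Adj c x ∧ T.Adj c y ∧ T.Adj c z ∧ x ≠ y ∧ x ≠ z ∧ y ≠ z

/-- The vertex set. -/
def clawVerts (c x y z : V) : Set V := {c, x, y, z}

theorem claw4_isClawSet (T : SimpleGraph V) (hT : T.IsTree) {c x y z : V}
    (h : Claw4 T c x y z) : IsClawSet T (clawVerts c x y z) := by
  obtain ⟨hx, hy, hz, hxy, hxz, hyz⟩ := h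
  have hna : ∀ a b, T.Adj c a → T.Adj c b → ¬ T.Adj a b := by
    intro a b ha hb hab
    apply hT.dist_ne_of_adj c hab
    rw [SimpleGraph.dist_eq_one_iff_adj.2 ha, SimpleGraph.dist_eq_one_iff_adj.2 hb]
  let f : Fin 1 ⊕ Fin 3 → clawVerts c x y z := fun s => match s with
    | Sum.inl _ => ⟨c, by simp [clawVerts]⟩
    | Sum.inr 0 => ⟨x, by simp [clawVerts]⟩
    | Sum.inr 1 => ⟨y, by simp [clawVerts]⟩
    | Sum.inr 2 => ⟨z, by simp [clawVerts]⟩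
  have hf : Function.Bijective f := by
    constructor
    · have n1 := hx.ne
      have n2 := hy.ne
      have n3 := hz.ne
      rintro (a | a) (b | b) hab <;> have hab := congrArg Subtype.val hab <;>
        fin_cases a <;> fin_cases b <;> first | rfl | (exfalso; simp only [f] at hab; grind)
    · rintro ⟨a, ha⟩
      simp only [clawVerts, Set.mem_insert_iff, Set.mem_singleton_iff] at ha
      rcases ha with rfl | rfl | rfl | rfl
      · exact ⟨Sum.inl 0, rfl⟩
      · exact ⟨Sum.inr 0, rfl⟩
      · exact ⟨Sum.inr 1, rfl⟩
      · exact ⟨Sum.inr 2, rfl⟩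
  refine ⟨RelIso.symm ⟨Equiv.ofBijective f hf, ?_⟩⟩
  rintro (a | a) (b | b) <;> fin_cases a <;> fin_cases b <;>
    simp [f, clawGraph, hx, hy, hz, hx.symm, hy.symm, hz.symm, hna]

theorem claw4_top {T : SimpleGraph V} {r : V} {d : V → ℕ} {p : V → V} (R : Rooted T r d p)
    {c x y z : V} (h : Claw4 T c x y z) :
    ∃ t ∈ clawVerts c x y z, ∀ v ∈ clawVerts c x y z,
      v = t ∨ (v ≠ r ∧ p v ∈ clawVerts c x y z ∧ d t ≤ d (p v)) := by
  obtain ⟨hx, hy, hz, hxy, hxz, hyz⟩ := h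
  rw [R.adj] at hx hy hz
  have := R.dp
  have d1 := R.dp c
  by_cases hc : c ≠ r ∧ p c ∈ clawVerts c x y z
  · refine ⟨p c, hc.2, ?_⟩
    have hc2 := hc.2
    simp only [clawVerts, Set.mem_insert_iff, Set.mem_singleton_iff] at *
    grind
  · refine ⟨c, by simp [clawVerts], ?_⟩
    simp only [clawVerts, Set.mem_insert_iff, Set.mem_singleton_iff] at *
    grind

theorem helly_step {T : SimpleGraph V} {r : V} {d : V → ℕ} {p : V → V} (R : Rooted T r d p)
    (C C' : Set V) (t t' : V)
    (hC : ∀ v ∈ C, v = t ∨ (v ≠ r ∧ p v ∈ C ∧ d t ≤ d (p v)))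
    (hC' : ∀ v ∈ C', v = t' ∨ (v ≠ r ∧ p v ∈ C' ∧ d t' ≤ d (p v)))
    (hd : d t' ≤ d t) : ∀ n x, d x = n → x ∈ C → x ∈ C' → t ∈ C' := by
  intro n
  induction n with
  | zero =>
    intro x hx h1 h2
    rcases hC x h1 with rfl | ⟨h, -⟩
    · exact h2
    · exact absurd ((R.d0 x).1 hx) h
  | succ n ih =>
    intro x hx h1 h2
    rcases hC x h1 with rfl | ⟨h, h3, h4⟩
    · exact h2
    · have h5 := R.dp x h
      rcases hC' x h2 with rfl | ⟨_, h6, _⟩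
      · omega
      · exact ih (p x) (by omega) h3 h6

theorem exists_center [Finite V] (T : SimpleGraph V) (hT : T.IsTree)
    (hno : ∀ c x y z c' x' y' z', Claw4 T c x y z → Claw4 T c' x' y' z' →
      ¬ Disjoint (clawVerts c x y z) (clawVerts c' x' y' z')) :
    ∃ r, ∀ c x y z, Claw4 T c x y z → r ∈ clawVerts c x y z := by
  obtain ⟨r⟩ := hT.connected.nonempty
  obtain ⟨d, p, R⟩ := exists_rooted T hT r
  let S : Set V := {t | ∃ c x y z, Claw4 T c x y z ∧ t ∈ clawVerts c x y z ∧
    ∀ v ∈ clawVerts c x y z, v = t ∨ (v ≠ r ∧ p v ∈ clawVerts c x y z ∧ d t ≤ d (p v))}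
  by_cases hS : S.Nonempty
  · obtain ⟨t, ⟨c, x, y, z, h1, h2, h3⟩, hmax⟩ := Set.exists_max_image S d S.toFinite hS
    refine ⟨t, fun c' x' y' z' h' => ?_⟩
    obtain ⟨t', ht', h4⟩ := claw4_top R h'
    have hle := hmax t' ⟨c', x', y', z', h', ht', h4⟩
    obtain ⟨w, hw, hw'⟩ := Set.not_disjoint_iff.1 (hno _ _ _ _ _ _ _ _ h1 h')
    exact helly_step R _ _ t t' h3 h4 hle _ w rfl hw hw'
  · refine ⟨r, fun c x y z h => (hS ?_).elim⟩
    obtain ⟨t, ht, h4⟩ := claw4_top R h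
    exact ⟨t, c, x, y, z, h, ht, h4⟩

/-- Parent map of `T1Inf`. -/
def parInf : T1InfVert → T1InfVert
  | Sum.inl _ => Sum.inl ()
  | Sum.inr (Sum.inl _) => Sum.inl ()
  | Sum.inr (Sum.inr (i, _, 0)) => Sum.inr (Sum.inl i)
  | Sum.inr (Sum.inr (i, j, n + 1)) => Sum.inr (Sum.inr (i, j, n))

theorem T1Inf_adj (a b : T1InfVert) : T1Inf.Adj a b ↔
    (a ≠ Sum.inl () ∧ parInf a = b) ∨ (b ≠ Sum.inl () ∧ parInf b = a) := by
  rcases a with a | a | ⟨i, j, m⟩ <;> rcases b with b | b | ⟨i', j', m'⟩ <;>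
    try rcases m with _ | m
  all_goals try rcases m' with _ | m'
  all_goals simp [T1Inf, parInf]
  all_goals grind

/-- The embedding into `T1Inf`. -/
def emb (d : V → ℕ) (p : V → V) (ix : V → ℕ) (side : V → Fin 2) (v : V) : T1InfVert :=
  match d v with
  | 0 => Sum.inl ()
  | 1 => Sum.inr (Sum.inl (ix v))
  | n + 2 => Sum.inr (Sum.inr (ix (p^[n+1] v), side (p^[n] v), n))

theorem mem_of_center [Finite V] (T : SimpleGraph V) (hT : T.IsTree) (r : V)
    (hr : ∀ c x y z, Claw4 T c x y z → r ∈ clawVerts c x y z) : MemT1Class T := by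
  classical
  obtain ⟨d, p, R⟩ := exists_rooted T hT r
  obtain ⟨n, ⟨e⟩⟩ := Finite.exists_equiv_fin V
  let ix : V → ℕ := fun v => (e v : ℕ)
  have hix : ∀ u v, ix u = ix v → u = v := fun u v h => e.injective (Fin.ext h)
  have hd : ∀ v, d v ≠ 0 → d (p v) + 1 = d v := fun v hv => R.dp v (fun h => hv ((R.d0 v).2 h))
  have hadj : ∀ v, d v ≠ 0 → T.Adj (p v) v := fun v hv =>
    (R.adj _ _).2 (Or.inr ⟨fun h => hv ((R.d0 v).2 h), rfl⟩)
  have hr0 : d r = 0 := (R.d0 r).2 rfl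
  -- at most two children at depth 1
  have hthree : ∀ u v w, d u = 2 → d v = 2 → d w = 2 → p u = p v → p w = p v →
      u ≠ v → u ≠ w → v ≠ w → False := by
    intro u v w hu hv hw huv hwv h1 h2 h3
    have := hr (p v) u v w ⟨huv ▸ hadj u (by omega), hadj v (by omega),
      hwv ▸ hadj w (by omega), h1, h2, h3⟩
    have := hd v (by omega)
    simp only [clawVerts, Set.mem_insert_iff, Set.mem_singleton_iff] at *
    grind
  have htwo : ∀ u v, 3 ≤ d u → 3 ≤ d v → p u = p v → u = v := by
    intro u v hu hv huv
    by_contra hne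
    have e1 := hd v (by omega)
    have e2 := hd (p v) (by omega)
    have e3 := hd u (by omega)
    have := hr (p v) (p (p v)) u v ⟨(hadj (p v) (by omega)).symm, huv ▸ hadj u (by omega),
      hadj v (by omega), by rintro rfl; grind, by rintro h; grind, hne⟩
    simp only [clawVerts, Set.mem_insert_iff, Set.mem_singleton_iff] at *
    grind
  let side : V → Fin 2 := fun v =>
    if ∃ u, d u = 2 ∧ p u = p v ∧ ix u < ix v then 1 else 0
  have hside' : ∀ u v, d u = 2 → d v = 2 → p u = p v → side u = side v → ¬ ix u < ix v := by
    intro u v hu hv hp hs hlt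
    have h1 : side v = 1 := if_pos ⟨u, hu, hp, hlt⟩
    rw [h1] at hs
    have h2 : ∃ w, d w = 2 ∧ p w = p u ∧ ix w < ix u := by
      by_contra hcon
      have : side u = 0 := if_neg hcon
      rw [this] at hs
      exact absurd hs (by decide)
    obtain ⟨w, hw, hwp, hwl⟩ := h2
    exact hthree u v w hu hv hw hp (hwp.trans hp) (by rintro rfl; omega) (by rintro rfl; omega)
      (by rintro rfl; omega)
  have hside : ∀ u v, d u = 2 → d v = 2 → p u = p v → side u = side v → u = v := by
    intro u v hu hv hp hs
    have h1 := hside' u v hu hv hp hs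
    have h2 := hside' v u hv hu hp.symm hs.symm
    exact hix _ _ (by omega)
  have hiter : ∀ n u v, d u = n + 2 → d v = n + 2 → p^[n] u = p^[n] v → u = v := by
    intro n
    induction n with
    | zero => intro u v _ _ h; exact h
    | succ n ih =>
      intro u v hu hv h
      have e1 := hd v (by omega)
      have e3 := hd u (by omega)
      exact htwo u v (by omega) (by omega) (ih (p u) (p v) (by omega) (by omega) h)
  have hditer : ∀ n k v, d v = n + k → d (p^[n] v) = k := by
    intro n
    induction n with
    | zero => intro k v h; simpa using h
    | succ n ih =>
      intro k v h
      have e1 := hd v (by omega)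
      exact ih k (p v) (by omega)
  let f := emb d p ix side
  have f0 : ∀ v, d v = 0 → f v = Sum.inl () := by
    intro v hv; simp only [f, emb, hv]
  have f1 : ∀ v, d v = 1 → f v = Sum.inr (Sum.inl (ix v)) := by
    intro v hv; simp only [f, emb, hv]
  have f2 : ∀ v n, d v = n + 2 →
      f v = Sum.inr (Sum.inr (ix (p^[n+1] v), side (p^[n] v), n)) := by
    intro v n hv; simp only [f, emb, hv]
  have hcases : ∀ v, d v = 0 ∨ d v = 1 ∨ ∃ n, d v = n + 2 := by
    intro v
    rcases hv : d v with _ | _ | n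
    · simp
    · simp
    · right; right; exact ⟨n, rfl⟩
  have hinj : Function.Injective f := by
    intro u v huv
    rcases hcases u with hu | hu | ⟨n, hu⟩ <;> rcases hcases v with hv | hv | ⟨m, hv⟩
    · rw [(R.d0 u).1 hu, (R.d0 v).1 hv]
    · rw [f0 u hu, f1 v hv] at huv; simp at huv
    · rw [f0 u hu, f2 v m hv] at huv; simp at huv
    · rw [f1 u hu, f0 v hv] at huv; simp at huv
    · rw [f1 u hu, f1 v hv] at huv
      exact hix _ _ (Sum.inl_injective (Sum.inr_injective huv))
    · rw [f1 u hu, f2 v m hv] at huv; simp at huv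
    · rw [f2 u n hu, f0 v hv] at huv; simp at huv
    · rw [f2 u n hu, f1 v hv] at huv; simp at huv
    · rw [f2 u n hu, f2 v m hv] at huv
      have h := Sum.inr_injective (Sum.inr_injective huv)
      simp only [Prod.mk.injEq] at h
      obtain ⟨h1, h2, rfl⟩ := h
      apply hiter n u v hu hv
      apply hside _ _ (hditer n 2 u hu) (hditer n 2 v hv) _ h2
      have := hix _ _ h1
      rwa [Function.iterate_succ_apply', Function.iterate_succ_apply'] at this
  have hpar : ∀ v, v ≠ r → parInf (f v) = f (p v) := by
    intro v hv
    have e1 := R.dp v hv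
    rcases hcases v with h | h | ⟨n, h⟩
    · exact absurd ((R.d0 v).1 h) hv
    · rw [f1 v h, f0 (p v) (by omega)]; rfl
    · rcases n with _ | n
      · rw [f2 v 0 h, f1 (p v) (by omega)]; rfl
      · rw [f2 v (n+1) h, f2 (p v) n (by omega)]; rfl
  have hfr : ∀ v, f v ≠ Sum.inl () ↔ v ≠ r := by
    intro v
    have : f r = Sum.inl () := f0 r hr0
    rw [← this]
    exact hinj.ne_iff
  have hiff : ∀ u v, T1Inf.Adj (f u) (f v) ↔ T.Adj u v := by
    intro u v
    rw [T1Inf_adj, R.adj, hfr, hfr]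
    constructor
    · rintro (⟨h1, h2⟩ | ⟨h1, h2⟩)
      · rw [hpar u h1] at h2; exact Or.inl ⟨h1, hinj h2⟩
      · rw [hpar v h1] at h2; exact Or.inr ⟨h1, hinj h2⟩
    · rintro (⟨h1, h2⟩ | ⟨h1, h2⟩)
      · exact Or.inl ⟨h1, by rw [hpar u h1, h2]⟩
      · exact Or.inr ⟨h1, by rw [hpar v h1, h2]⟩
  let iso : T ≃g T1Inf.induce (Set.range f) :=
    ⟨Equiv.ofInjective f hinj, by intro a b; simpa using hiff a b⟩
  exact ⟨Set.range f, iso.connected_iff.1 hT.connected, ⟨iso⟩⟩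

theorem statement6 (V : Type) [Fintype V] (T : SimpleGraph V) (hT : T.IsTree)
    (h : ¬ MemT1Class T) :
    ∃ A B : Set V, IsClawSet T A ∧ IsClawSet T B ∧ Disjoint A B := by
  by_contra hcon
  obtain ⟨r, hr⟩ := exists_center T hT (by
    intro c x y z c' x' y' z' h1 h2 hd
    exact hcon ⟨_, _, claw4_isClawSet T hT h1, claw4_isClawSet T hT h2, hd⟩)
  exact h (mem_of_center T hT r hr)

end Paper
end

section
/- Every forest having at least two connected components that do not belong to 𝒯₁ is negative. -/
open SimpleGraph

namespace Paper

variable {V W : Type*}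

/-- Adjacency in the ruler graph: `inl` are positions, `inr` are stars. -/
def DR : ℕ ⊕ ℕ → ℕ ⊕ ℕ → Prop
  | Sum.inl i, Sum.inl j => i + 1 = j ∨ j + 1 = i
  | Sum.inl i, Sum.inr h => ∃ q, i = 2 ^ h * (2 * q + 1)
  | Sum.inr h, Sum.inl i => ∃ q, i = 2 ^ h * (2 * q + 1)
  | Sum.inr _, Sum.inr _ => False

theorem reach_inv {U : Type*} {G : SimpleGraph U} (P : U → Prop)
    (h : ∀ x y, G.Adj x y → P x → P y) {x y : U} (hr : G.Reachable x y) (hx : P x) : P y := by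
  obtain ⟨p⟩ := hr
  induction p with
  | nil => exact hx
  | cons hadj _ ih => exact ih (h _ _ hadj hx)

theorem conn_inv {U : Type*} {G : SimpleGraph U} {S : Set U} (hS : (G.induce S).Connected)
    (P : U → Prop) (h : ∀ x ∈ S, ∀ y ∈ S, G.Adj x y → P x → P y) {x y : U}
    (hx : x ∈ S) (hy : y ∈ S) (hPx : P x) : P y :=
  reach_inv (G := G.induce S) (fun z => P z.1)
    (fun a b hab ha => h a.1 a.2 b.1 b.2 hab ha) (hS.preconnected ⟨x, hx⟩ ⟨y, hy⟩) hPx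

theorem star_pos_unique {i h h' : ℕ} (h1 : ∃ q, i = 2 ^ h * (2 * q + 1))
    (h2 : ∃ q, i = 2 ^ h' * (2 * q + 1)) : h = h' := by
  obtain ⟨q, hq⟩ := h1
  obtain ⟨q', hq'⟩ := h2
  have key : ∀ (a b x y : ℕ), a < b → 2 ^ a * (2 * x + 1) ≠ 2 ^ b * (2 * y + 1) := by
    intro a b x y hab he
    obtain ⟨k, rfl⟩ := Nat.exists_eq_add_of_lt hab
    have : 2 ^ (a + k + 1) * (2 * y + 1) = 2 ^ a * (2 * (2 ^ k * (2 * y + 1))) := by ring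
    rw [this] at he
    have := Nat.eq_of_mul_eq_mul_left (by positivity) he
    omega
  rcases lt_trichotomy h h' with hl | hl | hl
  · exact absurd (hq.symm.trans hq') (key _ _ _ _ hl)
  · exact hl
  · exact absurd (hq'.symm.trans hq) (key _ _ _ _ hl)

/-- Coordinates in `T1Inf`. -/
def psi (i a b : ℕ) : T1InfVert :=
  if a = b then Sum.inr (Sum.inl i)
  else if b < a then Sum.inr (Sum.inr (i, 0, a - b - 1))
  else Sum.inr (Sum.inr (i, 1, b - a - 1))

theorem psi_ne_root (i a b : ℕ) : psi i a b ≠ Sum.inl () := by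
  unfold psi; split_ifs <;> simp

theorem psi_fst {i j a b a' b' : ℕ} (h : psi i a b = psi j a' b') : i = j := by
  unfold psi at h
  split_ifs at h <;> simp_all

theorem psi_snd {i a b a' : ℕ} (h : psi i a b = psi i a' b) : a = a' := by
  unfold psi at h
  split_ifs at h <;> simp at h <;> omega

theorem psi_root (i a b : ℕ) : T1Inf.Adj (Sum.inl ()) (psi i a b) ↔ a = b := by
  unfold psi
  split_ifs <;> simp_all [T1Inf]

theorem psi_adj_fst {i j a b a' b' : ℕ} (h : T1Inf.Adj (psi i a b) (psi j a' b')) : i = j := by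
  unfold psi at h
  split_ifs at h <;> simp [T1Inf] at h <;> omega

theorem psi_adj (i a b a' : ℕ) :
    T1Inf.Adj (psi i a b) (psi i a' b) ↔ (a + 1 = a' ∨ a' + 1 = a) := by
  unfold psi
  split_ifs <;> simp [T1Inf] <;> omega

/-- Trees with a vertex whose removal leaves a linear forest. -/
theorem memT1_of_rank {W : Type*} [Fintype W] (T : SimpleGraph W) (hconn : T.Connected)
    (hac : T.IsAcyclic) (r : W) (ρ : W → ℕ)
    (hinj : ∀ u v, u ≠ r → v ≠ r → ρ u = ρ v → u = v)
    (hadj : ∀ u v, u ≠ r → v ≠ r → T.Adj u v → ρ u + 1 = ρ v ∨ ρ v + 1 = ρ u) :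
    MemT1Class T := by
  classical
  let T' : SimpleGraph W :=
    { Adj := fun u v => T.Adj u v ∧ u ≠ r ∧ v ≠ r
      symm := ⟨fun u v h => ⟨h.1.symm, h.2.2, h.2.1⟩⟩
      loopless := ⟨fun u h => T.loopless.irrefl u h.1⟩ }
  have hex : ∀ v, v ≠ r → ∃ n, T.Adj r n ∧ T'.Reachable n v := by
    intro v hv
    have := reach_inv (G := T) (fun v => v = r ∨ ∃ n, T.Adj r n ∧ T'.Reachable n v) (by
      intro x y hxy hx
      by_cases hy : y = r
      · exact Or.inl hy
      · right
        rcases hx with rfl | ⟨n, hn, hnx⟩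
        · exact ⟨y, hxy, Reachable.refl _⟩
        · by_cases hxr : x = r
          · subst hxr
            exact ⟨y, hxy, Reachable.refl _⟩
          · have : T'.Adj x y := ⟨hxy, hxr, hy⟩
            exact ⟨n, hn, hnx.trans this.reachable⟩) (hconn.preconnected r v) (Or.inl rfl)
    exact this.resolve_left hv
  have huniq : ∀ n n', T.Adj r n → T.Adj r n' → T'.Reachable n n' → n = n' := by
    intro n n' hn hn' hr
    by_contra hne
    have hb := isAcyclic_iff_forall_adj_isBridge.mp hac hn
    rw [isBridge_iff] at hb
    apply hb
    have h1 : (T \ fromEdgeSet {s(r, n)}).Adj r n' := by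
      simp only [sdiff_adj, fromEdgeSet_adj, Set.mem_singleton_iff]
      refine ⟨hn', ?_⟩
      rintro ⟨h, -⟩
      rw [Sym2.eq_iff] at h
      rcases h with h | h
      · exact hne h.2.symm
      · exact hn.ne h.1
    have hle : T' ≤ T \ fromEdgeSet {s(r, n)} := by
      intro x y hxy
      simp only [sdiff_adj, fromEdgeSet_adj, Set.mem_singleton_iff]
      refine ⟨hxy.1, ?_⟩
      rintro ⟨h, -⟩
      rw [Sym2.eq_iff] at h
      rcases h with h | h
      · exact hxy.2.1 h.1
      · exact hxy.2.2 h.2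
    exact h1.reachable.trans (hr.symm.mono hle)
  choose! nn hn1 hn2 using hex
  have hnr : ∀ v, v ≠ r → nn v ≠ r := fun v hv => (hn1 v hv).ne'
  have hroot : ∀ v, T.Adj r v ↔ v ≠ r ∧ nn v = v := by
    intro v
    constructor
    · intro h
      have hv : v ≠ r := h.ne'
      exact ⟨hv, huniq _ _ (hn1 v hv) h (hn2 v hv)⟩
    · rintro ⟨hv, h⟩
      have := hn1 v hv
      rwa [h] at this
  have hnre : ∀ u v, u ≠ r → v ≠ r → T'.Reachable u v → nn u = nn v := by
    intro u v hu hv h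
    exact huniq _ _ (hn1 u hu) (hn1 v hv) (((hn2 u hu).trans h).trans (hn2 v hv).symm)
  have hstep : ∀ v w, v ≠ r → w ≠ r → nn v = nn w → ρ v + 1 = ρ w → T.Adj v w := by
    intro v w hv hw hnn hρ
    by_contra hnot
    have hr : T'.Reachable v w := by
      have h1 := (hn2 v hv).symm
      rw [hnn] at h1
      exact h1.trans (hn2 w hw)
    have := reach_inv (G := T') (fun x => ρ x ≤ ρ v) (by
      intro x y hxy hx
      by_contra hy
      have h3 := hadj x y hxy.2.1 hxy.2.2 hxy.1
      have h4 : x = v := hinj _ _ hxy.2.1 hv (by omega)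
      have h5 : y = w := hinj _ _ hxy.2.2 hw (by omega)
      subst h4; subst h5
      exact hnot hxy.1) hr le_rfl
    omega
  have hiff : ∀ u v, u ≠ r → v ≠ r →
      (T.Adj u v ↔ nn u = nn v ∧ (ρ u + 1 = ρ v ∨ ρ v + 1 = ρ u)) := by
    intro u v hu hv
    constructor
    · intro h
      have : T'.Adj u v := ⟨h, hu, hv⟩
      exact ⟨hnre u v hu hv this.reachable, hadj u v hu hv h⟩
    · rintro ⟨h, h1 | h1⟩
      · exact hstep _ _ hu hv h h1
      · exact (hstep _ _ hv hu h.symm h1).symm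
  let e : W → ℕ := fun w => (Fintype.equivFin W w : ℕ)
  have he : ∀ a b, e a = e b ↔ a = b := by
    intro a b
    simp only [e]
    rw [Fin.val_inj, Equiv.apply_eq_iff_eq]
  let φ : W → T1InfVert := fun v =>
    if v = r then Sum.inl () else psi (e (nn v)) (ρ v) (ρ (nn v))
  have hφr : φ r = Sum.inl () := if_pos rfl
  have hφ : ∀ v, v ≠ r → φ v = psi (e (nn v)) (ρ v) (ρ (nn v)) := fun v hv => if_neg hv
  have hφinj : Function.Injective φ := by
    intro u v huv
    by_cases hu : u = r <;> by_cases hv : v = r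
    · rw [hu, hv]
    · rw [hu, hφr, hφ v hv] at huv
      exact absurd huv.symm (psi_ne_root _ _ _)
    · rw [hv, hφr, hφ u hu] at huv
      exact absurd huv (psi_ne_root _ _ _)
    · rw [hφ u hu, hφ v hv] at huv
      have h := (he _ _).mp (psi_fst huv)
      rw [h] at huv
      exact hinj _ _ hu hv (psi_snd huv)
  have hrootφ : ∀ v, v ≠ r → (T1Inf.Adj (φ r) (φ v) ↔ T.Adj r v) := by
    intro v hv
    rw [hφr, hφ v hv, psi_root, hroot]
    constructor
    · intro h
      exact ⟨hv, (hinj _ _ hv (hnr v hv) h).symm⟩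
    · rintro ⟨-, h⟩
      rw [h]
  have hφadj : ∀ u v, T1Inf.Adj (φ u) (φ v) ↔ T.Adj u v := by
    intro u v
    by_cases hu : u = r <;> by_cases hv : v = r
    · rw [hu, hv]
      exact ⟨fun h => absurd h (T1Inf.loopless.irrefl _), fun h => absurd h (T.loopless.irrefl _)⟩
    · rw [hu]; exact hrootφ v hv
    · rw [hv, T1Inf.adj_comm, T.adj_comm]; exact hrootφ u hu
    · rw [hiff u v hu hv, hφ u hu, hφ v hv]
      constructor
      · intro h
        have h1 := (he _ _).mp (psi_adj_fst h)
        rw [h1, psi_adj] at h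
        exact ⟨h1, h⟩
      · rintro ⟨h1, h⟩
        rw [h1, psi_adj]
        exact h
  let g : T ≃g T1Inf.induce (Set.range φ) :=
    ⟨Equiv.ofInjective φ hφinj, fun {a b} => hφadj a b⟩
  exact ⟨Set.range φ, g.connected_iff.mp hconn, ⟨g⟩⟩

/-- Position of a vertex (junk for stars). -/
def posOf : ℕ ⊕ ℕ → ℕ
  | Sum.inl i => i
  | Sum.inr _ => 0

theorem seg_convex {U : Type*} {G : SimpleGraph U} {e : U → ℕ ⊕ ℕ}
    (hG : ∀ x y, G.Adj x y ↔ DR (e x) (e y)) {S : Set U} (hS : (G.induce S).Connected)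
    (hpos : ∀ x ∈ S, ∃ i, e x = Sum.inl i) {x y : U} (hx : x ∈ S) (hy : y ∈ S) {t : ℕ}
    (h1 : posOf (e x) ≤ t) (h2 : t ≤ posOf (e y)) : ∃ z ∈ S, e z = Sum.inl t := by
  by_contra hno
  push Not at hno
  have hne : ∀ z ∈ S, posOf (e z) ≠ t := by
    intro z hz h
    obtain ⟨i, hi⟩ := hpos z hz
    apply hno z hz
    rw [hi] at h ⊢
    rw [← h]; rfl
  have := conn_inv hS (fun z => posOf (e z) < t) (by
    intro a ha b hb hab hlt
    obtain ⟨i, hi⟩ := hpos a ha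
    obtain ⟨j, hj⟩ := hpos b hb
    have h3 := hne b hb
    rw [hG, hi, hj] at hab
    rw [hi] at hlt
    rw [hj] at h3 ⊢
    simp only [DR, posOf] at *
    omega) hx hy (lt_of_le_of_ne h1 (hne x hx))
  omega

theorem few_stars {V : Type*} [Fintype V] {F : SimpleGraph V} (hF : F.IsAcyclic)
    (c : F.ConnectedComponent) {U : Type*} {G : SimpleGraph U} {e : U → ℕ ⊕ ℕ}
    (he : Function.Injective e)
    (hG : ∀ x y, G.Adj x y ↔ DR (e x) (e y)) {M : V → Set U} (hM : IsInducedMinorModel F G M)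
    (r : V) (hr : r ∈ c.supp)
    (hpos : ∀ v ∈ c.supp, v ≠ r → ∀ x ∈ M v, ∃ i, e x = Sum.inl i) :
    MemT1Class (F.induce c.supp) := by
  classical
  obtain ⟨hne, hconn, hdisj, hadj⟩ := hM
  choose xx hxx using hne
  let p : V → ℕ := fun v => posOf (e (xx v))
  have hdis : ∀ u v x, x ∈ M u → x ∈ M v → u = v := by
    intro u v x hu hv
    by_contra h
    exact Set.disjoint_left.mp (hdisj h) hu hv
  have hp : ∀ v ∈ c.supp, v ≠ r → e (xx v) = Sum.inl (p v) := by
    intro v hv hvr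
    obtain ⟨i, hi⟩ := hpos v hv hvr _ (hxx v)
    simp only [p, hi, posOf]
  have hpinj : ∀ u ∈ c.supp, ∀ v ∈ c.supp, u ≠ r → v ≠ r → p u = p v → u = v := by
    intro u hu v hv hur hvr h
    have h1 := hp u hu hur
    rw [h, ← hp v hv hvr] at h1
    have h2 := he h1
    exact hdis u v (xx u) (hxx u) (h2 ▸ hxx v)
  -- convexity: the representative of `w` lies in no other segment
  have hconv : ∀ u ∈ c.supp, ∀ w ∈ c.supp, u ≠ r → w ≠ r → ∀ a ∈ M u, ∀ b ∈ M u,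
      posOf (e a) ≤ p w → p w ≤ posOf (e b) → u = w := by
    intro u hu w hw hur hwr a ha b hb h1 h2
    obtain ⟨z, hz, hez⟩ := seg_convex hG (hconn u) (hpos u hu hur) ha hb h1 h2
    rw [← hp w hw hwr] at hez
    have := he hez
    subst this
    exact hdis _ _ _ hz (hxx w)
  let T : V → Finset V := fun v =>
    Finset.univ.filter (fun x => x ∈ c.supp ∧ x ≠ r ∧ p x < p v)
  have hcons : ∀ u ∈ c.supp, ∀ v ∈ c.supp, u ≠ r → v ≠ r → F.Adj u v → p u < p v →
      (T u).card + 1 = (T v).card := by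
    intro u hu v hv hur hvr huv hlt
    have hins : T v = insert u (T u) := by
      ext w
      simp only [T, Finset.mem_filter, Finset.mem_univ, true_and, Finset.mem_insert]
      constructor
      · rintro ⟨hw, hwr, hwv⟩
        by_contra hcon
        push Not at hcon
        obtain ⟨hwu, hcon⟩ := hcon
        have h1 := hcon hw hwr
        obtain ⟨a, ha, b, hb, hab⟩ := (hadj u v huv.ne).mpr huv
        obtain ⟨i, hi⟩ := hpos u hu hur a ha
        obtain ⟨j, hj⟩ := hpos v hv hvr b hb
        rw [hG, hi, hj] at hab
        simp only [DR] at hab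
        by_cases hc : p w ≤ i
        · exact hwu (hconv u hu w hw hur hwr (xx u) (hxx u) a ha h1 (by rw [hi]; exact hc)).symm
        · have := hconv v hv w hw hvr hwr b hb (xx v) (hxx v)
            (by rw [hj]; simp only [posOf]; omega) hwv.le
          subst this
          exact lt_irrefl _ hwv
      · rintro (rfl | ⟨h1, h2, h3⟩)
        · exact ⟨hu, hur, hlt⟩
        · exact ⟨h1, h2, h3.trans hlt⟩
    rw [hins, Finset.card_insert_of_notMem]
    simp [T]
  have hmono : ∀ u ∈ c.supp, ∀ v ∈ c.supp, u ≠ r → v ≠ r → p u < p v →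
      (T u).card < (T v).card := by
    intro u hu v hv hur hvr hlt
    apply Finset.card_lt_card
    rw [Finset.ssubset_iff_of_subset]
    · exact ⟨u, by simp [T, hlt, hur]; exact hu, by simp [T]⟩
    · intro w
      simp only [T, Finset.mem_filter, Finset.mem_univ, true_and]
      rintro ⟨h1, h2, h3⟩
      exact ⟨h1, h2, h3.trans hlt⟩
  have : Fintype c.supp := Fintype.ofFinite _
  refine memT1_of_rank (F.induce c.supp) c.connected_toSimpleGraph (hF.induce _) ⟨r, hr⟩
    (fun v => (T v.1).card) ?_ ?_
  · rintro ⟨u, hu⟩ ⟨v, hv⟩ hur hvr h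
    have hur' : u ≠ r := fun h => hur (Subtype.ext h)
    have hvr' : v ≠ r := fun h => hvr (Subtype.ext h)
    apply Subtype.ext
    apply hpinj u hu v hv hur' hvr'
    simp only at h
    rcases lt_trichotomy (p u) (p v) with h1 | h1 | h1
    · have := hmono u hu v hv hur' hvr' h1; omega
    · exact h1
    · have := hmono v hv u hu hvr' hur' h1; omega
  · rintro ⟨u, hu⟩ ⟨v, hv⟩ hur hvr h
    have hur' : u ≠ r := fun h => hur (Subtype.ext h)
    have hvr' : v ≠ r := fun h => hvr (Subtype.ext h)
    have huv : F.Adj u v := h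
    simp only
    rcases lt_trichotomy (p u) (p v) with h1 | h1 | h1
    · left; exact hcons u hu v hv hur' hvr' huv h1
    · exact absurd (hpinj u hu v hv hur' hvr' h1) huv.ne
    · right; exact hcons v hv u hu hvr' hur' huv.symm h1

theorem two_stars {V : Type*} [Fintype V] {F : SimpleGraph V} (hF : F.IsAcyclic)
    (c : F.ConnectedComponent) {U : Type*} {G : SimpleGraph U} {e : U → ℕ ⊕ ℕ}
    (he : Function.Injective e)
    (hG : ∀ x y, G.Adj x y ↔ DR (e x) (e y)) {M : V → Set U} (hM : IsInducedMinorModel F G M)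
    (hc : ¬ MemT1Class (F.induce c.supp)) :
    ∃ h h', h ≠ h' ∧ (∃ v ∈ c.supp, ∃ x ∈ M v, e x = Sum.inr h) ∧
      (∃ v ∈ c.supp, ∃ x ∈ M v, e x = Sum.inr h') := by
  by_contra hcon
  push Not at hcon
  apply hc
  by_cases hs : ∃ h, ∃ v ∈ c.supp, ∃ x ∈ M v, e x = Sum.inr h
  · obtain ⟨h, r, hr, x, hx, hex⟩ := hs
    refine few_stars hF c he hG hM r hr ?_
    intro v hv hvr y hy
    rcases hey : e y with i | h'
    · exact ⟨i, rfl⟩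
    · exfalso
      by_cases hh : h = h'
      · subst hh
        have := he (hex.trans hey.symm)
        subst this
        exact Set.disjoint_left.mp (hM.2.2.1 hvr) hy hx
      · exact hcon h h' hh ⟨r, hr, x, hx, hex⟩ v hv y hy hey
  · push Not at hs
    obtain ⟨r, hr⟩ := c.nonempty_supp
    refine few_stars hF c he hG hM r hr ?_
    intro v hv _ y hy
    rcases hey : e y with i | h'
    · exact ⟨i, rfl⟩
    · exact absurd hey (hs h' v hv y hy)

theorem union_const {V : Type*} {F : SimpleGraph V}
    (d : F.ConnectedComponent) {U : Type*} {G : SimpleGraph U}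
    {M : V → Set U} (hM : IsInducedMinorModel F G M) (σ : U → ℕ)
    (h : ∀ u ∈ d.supp, ∀ v ∈ d.supp, ∀ x ∈ M u, ∀ y ∈ M v, G.Adj x y → σ x = σ y) :
    ∀ u ∈ d.supp, ∀ v ∈ d.supp, ∀ x ∈ M u, ∀ y ∈ M v, σ x = σ y := by
  intro u hu v hv x hx y hy
  have hin : ∀ w ∈ d.supp, ∀ a ∈ M w, ∀ b ∈ M w, σ a = σ b := by
    intro w hw a ha b hb
    exact conn_inv (hM.2.1 w) (fun z => σ a = σ z)
      (fun p hp q hq hpq h1 => h1.trans (h w hw w hw p hp q hq hpq)) ha hb rfl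
  have hr : F.Reachable u v := by
    rw [ConnectedComponent.mem_supp_iff] at hu hv
    exact ConnectedComponent.exact (hu.trans hv.symm)
  have := reach_inv (G := F) (fun w => w ∈ d.supp ∧ ∀ b ∈ M w, σ x = σ b) (by
    rintro a b hab ⟨ha, hσ⟩
    have hb : b ∈ d.supp := by
      rw [ConnectedComponent.mem_supp_iff] at ha ⊢
      rw [← ha]
      exact ConnectedComponent.sound hab.symm.reachable
    refine ⟨hb, ?_⟩
    intro z hz
    obtain ⟨p, hp, q, hq, hpq⟩ := (hM.2.2.2 a b hab.ne).mpr hab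
    exact ((hσ p hp).trans (h a ha b hb p hp q hq hpq)).trans (hin b hb q hq z hz))
    hr ⟨hu, hin u hu x hx⟩
  exact this.2 y hy

/-- The component label. -/
def sig (g : ℕ) : ℕ ⊕ ℕ → ℕ
  | Sum.inl j => padicValNat 2 ((j + 2 ^ g) / 2 ^ (g + 1))
  | Sum.inr h => h - (g + 1)

theorem sig_star {g h j : ℕ} (hg : g < h) (hj : ∃ q, j = 2 ^ h * (2 * q + 1)) :
    sig g (Sum.inl j) = sig g (Sum.inr h) := by
  obtain ⟨q, rfl⟩ := hj
  obtain ⟨k, rfl⟩ := Nat.exists_eq_add_of_lt hg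
  simp only [sig]
  have h1 : (2 ^ (g + k + 1) * (2 * q + 1) + 2 ^ g) / 2 ^ (g + 1) = 2 ^ k * (2 * q + 1) := by
    have : 2 ^ (g + k + 1) * (2 * q + 1) + 2 ^ g
      = 2 ^ g + 2 ^ (g + 1) * (2 ^ k * (2 * q + 1)) := by ring
    rw [this, Nat.add_mul_div_left _ _ (by positivity), Nat.div_eq_of_lt, zero_add]
    exact Nat.pow_lt_pow_right (by norm_num) (by omega)
  rw [h1, padicValNat.mul (by positivity) (by positivity), padicValNat.prime_pow,
    padicValNat.eq_zero_of_not_dvd (by omega)]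
  omega

theorem sig_step {g j : ℕ} (hj : ¬ ∃ q, j + 1 = 2 ^ g * (2 * q + 1)) :
    sig g (Sum.inl j) = sig g (Sum.inl (j + 1)) := by
  simp only [sig]
  congr 1
  rw [show j + 1 + 2 ^ g = (j + 2 ^ g) + 1 by ring, Nat.succ_div, if_neg, add_zero]
  rintro ⟨k, hk⟩
  apply hj
  rcases k with _ | k
  · simp at hk
  · refine ⟨k, ?_⟩
    have : 2 ^ (g + 1) * (k + 1) = 2 ^ g * (2 * k + 1) + 2 ^ g := by ring
    omega

theorem no_cross {V : Type*} {F : SimpleGraph V}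
    (c d : F.ConnectedComponent) (hcd : c ≠ d) {U : Type*} {G : SimpleGraph U} {e : U → ℕ ⊕ ℕ}
    (hG : ∀ x y, G.Adj x y ↔ DR (e x) (e y)) {M : V → Set U} (hM : IsInducedMinorModel F G M)
    {g : ℕ} (hz : ∃ v ∈ c.supp, ∃ x ∈ M v, e x = Sum.inr g)
    (hmin : ∀ h, (∃ v ∈ d.supp, ∃ x ∈ M v, e x = Sum.inr h) → g < h)
    {h h' : ℕ} (hh : h ≠ h') (h1 : ∃ v ∈ d.supp, ∃ x ∈ M v, e x = Sum.inr h)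
    (h2 : ∃ v ∈ d.supp, ∃ x ∈ M v, e x = Sum.inr h') : False := by
  obtain ⟨w, hw, z, hzw, hez⟩ := hz
  have hlev : ∀ v ∈ d.supp, ∀ x ∈ M v, ∀ i, e x = Sum.inl i → ¬ ∃ q, i = 2 ^ g * (2 * q + 1) := by
    intro v hv x hx i hi hq
    have hadj : G.Adj z x := by rw [hG, hez, hi]; exact hq
    rw [ConnectedComponent.mem_supp_iff] at hw hv
    have hne : w ≠ v := by
      rintro rfl
      exact hcd (hw.symm.trans hv)
    have := (hM.2.2.2 w v hne).mp ⟨z, hzw, x, hx, hadj⟩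
    exact hcd (hw.symm.trans ((ConnectedComponent.sound this.reachable).trans hv))
  have hc := union_const d hM (fun x => sig g (e x)) (by
    intro u hu v hv x hx y hy hxy
    rw [hG] at hxy
    rcases hex : e x with i | a <;> rcases hey : e y with j | b <;> rw [hex, hey] at hxy
    · rcases hxy with hxy | hxy
      · subst hxy; exact sig_step (hlev v hv y hy _ hey)
      · subst hxy; exact (sig_step (hlev u hu x hx _ hex)).symm
    · exact sig_star (hmin b ⟨v, hv, y, hy, hey⟩) hxy
    · exact (sig_star (hmin a ⟨u, hu, x, hx, hex⟩) hxy).symm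
    · exact hxy.elim)
  have g1 := hmin _ h1
  have g2 := hmin _ h2
  obtain ⟨u, hu, x, hx, hex⟩ := h1
  obtain ⟨v, hv, y, hy, hey⟩ := h2
  have := hc u hu v hv x hx y hy
  simp only [hex, hey, sig] at this
  omega

theorem not_minor {V : Type*} [Fintype V] {F : SimpleGraph V} (hF : F.IsAcyclic)
    (c d : F.ConnectedComponent) (hcd : c ≠ d)
    (hc : ¬ MemT1Class (F.induce c.supp)) (hd : ¬ MemT1Class (F.induce d.supp))
    {U : Type*} {G : SimpleGraph U} {e : U → ℕ ⊕ ℕ} (he : Function.Injective e)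
    (hG : ∀ x y, G.Adj x y ↔ DR (e x) (e y)) : ¬ InducedMinor F G := by
  classical
  rintro ⟨M, hM⟩
  obtain ⟨a, a', haa, ha, ha'⟩ := two_stars hF c he hG hM hc
  obtain ⟨b, b', hbb, hb, hb'⟩ := two_stars hF d he hG hM hd
  have hca : ∃ h, ∃ v ∈ c.supp, ∃ x ∈ M v, e x = Sum.inr h := ⟨a, ha⟩
  have hdb : ∃ h, ∃ v ∈ d.supp, ∃ x ∈ M v, e x = Sum.inr h := ⟨b, hb⟩
  rcases lt_trichotomy (Nat.find hca) (Nat.find hdb) with h | h | h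
  · exact no_cross c d hcd hG hM (Nat.find_spec hca)
      (fun k hk => h.trans_le (Nat.find_min' hdb hk)) hbb hb hb'
  · obtain ⟨u, hu, x, hx, hex⟩ := Nat.find_spec hca
    obtain ⟨v, hv, y, hy, hey⟩ := Nat.find_spec hdb
    rw [h, ← hey] at hex
    have := he hex
    subst this
    have huv : u ≠ v := by
      rintro rfl
      rw [ConnectedComponent.mem_supp_iff] at hu hv
      exact hcd (hu.symm.trans hv)
    exact Set.disjoint_left.mp (hM.2.2.1 huv) hx hy
  · exact no_cross d c hcd.symm hG hM (Nat.find_spec hdb)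
      (fun k hk => h.trans_le (Nat.find_min' hca hk)) haa ha ha'

theorem no_biclique {U : Type*} {G : SimpleGraph U} {e : U → ℕ ⊕ ℕ} (he : Function.Injective e)
    (hG : ∀ x y, G.Adj x y ↔ DR (e x) (e y)) : ¬ HasSubgraphCopy G (Ktt 4) := by
  rintro ⟨f, hf, hadj⟩
  have hA : ∀ i j : Fin 4, DR (e (f (Sum.inl i))) (e (f (Sum.inr j))) := by
    intro i j
    rw [← hG]
    exact hadj _ _ (by simp [Ktt])
  let L : Fin 4 → ℕ ⊕ ℕ := fun i => e (f (Sum.inl i))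
  let R : Fin 4 → ℕ ⊕ ℕ := fun i => e (f (Sum.inr i))
  have hL : Function.Injective L := he.comp (hf.comp Sum.inl_injective)
  have hR : Function.Injective R := he.comp (hf.comp Sum.inr_injective)
  have hA' : ∀ i j, DR (L i) (R j) := hA
  obtain ⟨i, p, hp⟩ : ∃ i p, L i = Sum.inl p := by
    by_contra hcon
    push Not at hcon
    rcases h0 : L 0 with p | a
    · exact hcon 0 p h0
    rcases h1 : L 1 with p | b
    · exact hcon 1 p h1
    have k0 := hA' 0 0
    have k1 := hA' 1 0
    rw [h0] at k0
    rw [h1] at k1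
    rcases hr : R 0 with q | q <;> rw [hr] at k0 k1
    · have := star_pos_unique k0 k1
      subst this
      exact absurd (hL (h0.trans h1.symm)) (by decide)
    · exact k0
  have hstar : ∀ j j' a b, R j = Sum.inr a → R j' = Sum.inr b → j = j' := by
    intro j j' a b ha hb
    have k0 := hA' i j
    have k1 := hA' i j'
    rw [hp, ha] at k0
    rw [hp, hb] at k1
    have := star_pos_unique k0 k1
    subst this
    exact hR (ha.trans hb.symm)
  have hposn : ∀ j q, R j = Sum.inl q → p + 1 = q ∨ q + 1 = p := by
    intro j q hq
    have k0 := hA' i j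
    rw [hp, hq] at k0
    exact k0
  have hdist : ∀ j j' q q', R j = Sum.inl q → R j' = Sum.inl q' → j ≠ j' → q ≠ q' := by
    intro j j' q q' h1 h2 hne hqq
    subst hqq
    exact hne (hR (h1.trans h2.symm))
  have three : ∀ j1 j2 j3 : Fin 4, j1 ≠ j2 → j1 ≠ j3 → j2 ≠ j3 → ∀ q1 q2 q3,
      R j1 = Sum.inl q1 → R j2 = Sum.inl q2 → R j3 = Sum.inl q3 → False := by
    intro j1 j2 j3 h12 h13 h23 q1 q2 q3 e1 e2 e3
    have := hposn _ _ e1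
    have := hposn _ _ e2
    have := hposn _ _ e3
    have := hdist _ _ _ _ e1 e2 h12
    have := hdist _ _ _ _ e1 e3 h13
    have := hdist _ _ _ _ e2 e3 h23
    omega
  rcases h0 : R 0 with q0 | q0 <;> rcases h1 : R 1 with q1 | q1
  · rcases h2 : R 2 with q2 | q2
    · exact three 0 1 2 (by decide) (by decide) (by decide) _ _ _ h0 h1 h2
    · rcases h3 : R 3 with q3 | q3
      · exact three 0 1 3 (by decide) (by decide) (by decide) _ _ _ h0 h1 h3
      · exact absurd (hstar _ _ _ _ h2 h3) (by decide)
  · rcases h2 : R 2 with q2 | q2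
    · rcases h3 : R 3 with q3 | q3
      · exact three 0 2 3 (by decide) (by decide) (by decide) _ _ _ h0 h2 h3
      · exact absurd (hstar _ _ _ _ h1 h3) (by decide)
    · exact absurd (hstar _ _ _ _ h1 h2) (by decide)
  · rcases h2 : R 2 with q2 | q2
    · rcases h3 : R 3 with q3 | q3
      · exact three 1 2 3 (by decide) (by decide) (by decide) _ _ _ h1 h2 h3
      · exact absurd (hstar _ _ _ _ h0 h3) (by decide)
    · exact absurd (hstar _ _ _ _ h0 h2) (by decide)
  · exact absurd (hstar _ _ _ _ h0 h1) (by decide)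

theorem interval_cross {k m : ℕ} [NeZero m] (A C : Fin m → Set (Fin (k + 1)))
    (hA : ∀ h, ∀ i j l : Fin (k + 1), i ≤ j → j ≤ l → i ∈ A h → l ∈ A h → j ∈ A h)
    (hC : ∀ h, ∀ i j l : Fin (k + 1), i ≤ j → j ≤ l → i ∈ C h → l ∈ C h → j ∈ C h)
    (hAC : ∀ h p, ∃ t, t ∈ A h ∧ t ∈ C p) :
    ∃ t, (∀ h, t ∈ A h) ∨ (∀ p, t ∈ C p) := by
  have hne : ∀ h, (A h).Nonempty := fun h => by
    obtain ⟨t, ht, -⟩ := hAC h 0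
    exact ⟨t, ht⟩
  have hmin : ∀ h, ∃ t ∈ A h, ∀ s ∈ A h, t ≤ s := fun h =>
    Set.exists_min_image (A h) id (Set.toFinite _) (hne h)
  have hmax : ∀ h, ∃ t ∈ A h, ∀ s ∈ A h, s ≤ t := fun h =>
    Set.exists_max_image (A h) id (Set.toFinite _) (hne h)
  choose l hl1 hl2 using hmin
  choose r hr1 hr2 using hmax
  obtain ⟨h0, hh0⟩ := Finite.exists_max l
  obtain ⟨h1, hh1⟩ := Finite.exists_min r
  by_cases hle : l h0 ≤ r h1
  · exact ⟨l h0, Or.inl fun h => hA h (l h) _ (r h) (hh0 h) (hle.trans (hh1 h)) (hl1 h) (hr1 h)⟩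
  · push Not at hle
    refine ⟨r h1, Or.inr fun p => ?_⟩
    obtain ⟨x, hx1, hx2⟩ := hAC h1 p
    obtain ⟨y, hy1, hy2⟩ := hAC h0 p
    exact hC p x _ y (hr2 _ _ hx1) (hle.le.trans (hl2 _ _ hy1)) hx2 hy2

theorem card_bag {U : Type*} [Finite U] {m : ℕ} (f : Fin m → U) (hf : Function.Injective f)
    (B : Set U) (h : ∀ i, f i ∈ B) : m ≤ B.ncard := by
  have h1 : (f '' Set.univ).ncard ≤ B.ncard :=
    Set.ncard_le_ncard (by rintro _ ⟨i, -, rfl⟩; exact h i) (Set.toFinite _)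
  rw [Set.ncard_image_of_injective _ hf, Set.ncard_univ, Nat.card_fin] at h1
  exact h1

theorem pw_lower {U : Type*} [Finite U] {G : SimpleGraph U} {e : U → ℕ ⊕ ℕ}
    (hG : ∀ x y, G.Adj x y ↔ DR (e x) (e y)) {m : ℕ} [NeZero m] (P : ℕ → U) (s : Fin m → U)
    (hP : ∀ i, i < m * 2 ^ m → e (P i) = Sum.inl i) (hs : ∀ h, e (s h) = Sum.inr h.1)
    {w : ℕ} (hw : HasPWAtMost G w) : m ≤ w + 1 := by
  obtain ⟨k, B, -, hedge, hconv, hcard⟩ := hw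
  have hlt : ∀ (p : Fin m) i, i < 2 ^ m → p.1 * 2 ^ m + i < m * 2 ^ m := by
    intro p i hi
    have : (p.1 + 1) * 2 ^ m ≤ m * 2 ^ m := Nat.mul_le_mul_right _ p.2
    rw [Nat.add_mul] at this
    omega
  obtain ⟨t, ht⟩ := interval_cross (fun h : Fin m => {t | s h ∈ B t})
    (fun p : Fin m => {t | ∃ i, i < 2 ^ m ∧ P (p.1 * 2 ^ m + i) ∈ B t})
    (fun h i j l h1 h2 h3 h4 => hconv (s h) i j l h1 h2 h3 h4)
    (by
      rintro p t1 t t2 h1 h2 ⟨a, ha, hat⟩ ⟨b, hb, hbt⟩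
      by_contra hno
      simp only [Set.mem_ofPred_eq, not_exists, not_and] at hno
      have hS : ∀ i, i < 2 ^ m → ((∃ t', t' ≤ t ∧ P (p.1 * 2 ^ m + i) ∈ B t') ↔
          (∃ t', t' ≤ t ∧ P (p.1 * 2 ^ m + 0) ∈ B t')) := by
        intro i
        induction i with
        | zero => intro _; rfl
        | succ i ih =>
          intro hi
          rw [← ih (by omega)]
          have hadj : G.Adj (P (p.1 * 2 ^ m + i)) (P (p.1 * 2 ^ m + (i + 1))) := by
            rw [hG, hP _ (hlt p i (by omega)), hP _ (hlt p _ hi)]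
            left; omega
          obtain ⟨u, hu1, hu2⟩ := hedge _ _ hadj
          rcases le_total u t with hut | hut
          · exact ⟨fun _ => ⟨u, hut, hu1⟩, fun _ => ⟨u, hut, hu2⟩⟩
          · constructor
            · rintro ⟨t', ht', hm⟩
              exact absurd (hconv _ _ _ _ ht' hut hm hu2) (hno _ hi)
            · rintro ⟨t', ht', hm⟩
              exact absurd (hconv _ _ _ _ ht' hut hm hu1) (hno _ (by omega))
      obtain ⟨t', ht', hm⟩ := (hS b hb).mpr ((hS a ha).mp ⟨t1, h1, hat⟩)
      exact hno b hb (hconv _ _ _ _ ht' h2 hm hbt))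
    (by
      intro h p
      have hh : 2 ^ h.1 < 2 ^ m := Nat.pow_lt_pow_right (by norm_num) h.2
      have hadj : G.Adj (s h) (P (p.1 * 2 ^ m + 2 ^ h.1)) := by
        rw [hG, hs, hP _ (hlt p _ hh)]
        obtain ⟨j, hj⟩ := Nat.exists_eq_add_of_lt h.2
        refine ⟨p.1 * 2 ^ j, ?_⟩
        rw [show (2 : ℕ) ^ m = 2 ^ (h.1 + j + 1) from congrArg _ hj]
        ring
      obtain ⟨u, hu1, hu2⟩ := hedge _ _ hadj
      exact ⟨u, hu1, _, hh, hu2⟩)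
  refine le_trans ?_ (hcard t)
  rcases ht with ht | ht
  · refine card_bag s ?_ _ ht
    intro a b hab
    have := congrArg e hab
    rw [hs, hs] at this
    exact Fin.ext (Sum.inr.inj this)
  · choose i hi1 hi2 using ht
    refine card_bag (fun p => P (p.1 * 2 ^ m + i p)) ?_ _ hi2
    intro a b hab
    have := congrArg e hab
    simp only at this
    rw [hP _ (hlt a _ (hi1 a)), hP _ (hlt b _ (hi1 b))] at this
    have h1 := congrArg (· / 2 ^ m) (Sum.inl.inj this)
    have hd : ∀ x y : ℕ, y < 2 ^ m → (x * 2 ^ m + y) / 2 ^ m = x := by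
      intro x y hy
      rw [Nat.add_comm, Nat.add_mul_div_right _ _ (by positivity), Nat.div_eq_of_lt hy, zero_add]
    rw [hd _ _ (hi1 a), hd _ _ (hi1 b)] at h1
    exact Fin.ext h1

/-- Labels of the vertices of the ruler graph. -/
def lab (m : ℕ) (x : Fin (m * 2 ^ m + m)) : ℕ ⊕ ℕ :=
  Sum.map Fin.val Fin.val (finSumFinEquiv.symm x)

theorem lab_inj (m : ℕ) : Function.Injective (lab m) :=
  (Sum.map_injective.mpr ⟨Fin.val_injective, Fin.val_injective⟩).comp
    finSumFinEquiv.symm.injective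

/-- The ruler graph. -/
def ruler (m : ℕ) : SimpleGraph (Fin (m * 2 ^ m + m)) where
  Adj x y := DR (lab m x) (lab m y)
  symm := ⟨by
    intro x y h
    rcases hx : lab m x with i | i <;> rcases hy : lab m y with j | j <;> rw [hx, hy] at h
    · exact h.symm
    · exact h
    · exact h
    · exact h⟩
  loopless := ⟨by
    intro x h
    rcases hx : lab m x with i | i <;> rw [hx] at h
    · simp only [DR] at h; omega
    · exact h⟩

theorem hasPW_trivial {n : ℕ} (G : SimpleGraph (Fin n)) : HasPWAtMost G n := by
  refine ⟨0, fun _ => Set.univ, fun v => ⟨0, trivial⟩, fun u v _ => ⟨0, trivial, trivial⟩,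
    fun _ _ _ _ _ _ _ _ => trivial, fun _ => ?_⟩
  rw [Set.ncard_univ, Nat.card_fin]
  omega

theorem statement7 (V : Type) [Fintype V] (F : SimpleGraph V) (hF : F.IsAcyclic)
    (c d : F.ConnectedComponent) (hcd : c ≠ d)
    (hc : ¬ MemT1Class (F.induce c.supp)) (hd : ¬ MemT1Class (F.induce d.supp)) :
    IsNegative F := by
  refine ⟨Set.range (fun m : ℕ => ⟨m * 2 ^ m + m, ruler m⟩), ⟨4, by norm_num, ?_⟩, ?_, ?_⟩
  · rintro _ ⟨m, rfl⟩
    exact no_biclique (lab_inj m) (fun _ _ => Iff.rfl)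
  · rintro _ ⟨m, rfl⟩
    exact not_minor hF c d hcd hc hd (lab_inj m) (fun _ _ => Iff.rfl)
  · rintro ⟨w, hw⟩
    have h1 := hw _ ⟨w + 2, rfl⟩
    simp only at h1
    have h2 : HasPWAtMost (ruler (w + 2)) (pathwidth (ruler (w + 2))) :=
      Nat.sInf_mem (s := {w' | HasPWAtMost (ruler (w + 2)) w'}) ⟨_, hasPW_trivial _⟩
    have h3 := pw_lower (G := ruler (w + 2)) (e := lab (w + 2)) (fun _ _ => Iff.rfl)
      (fun i => if h : i < (w + 2) * 2 ^ (w + 2) then finSumFinEquiv (Sum.inl ⟨i, h⟩)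
        else finSumFinEquiv (Sum.inr 0))
      (fun h => finSumFinEquiv (Sum.inr h))
      (by
        intro i hi
        rw [dif_pos hi, lab, Equiv.symm_apply_apply]; rfl)
      (by
        intro h
        rw [lab, Equiv.symm_apply_apply]; rfl) h2
    omega

end Paper
end
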